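/- arXiv:math/0409205 — 2 statements merged into one kernel-verified Lean document; each statement's English description precedes it below -/
import Mathlib

section
/- (Birman–Ko–Lee) In the Birman–Ko–Lee monoid BKL_n⁺, the set of left divisors of the element δ_n = σ_{n−1,n} σ_{n−2,n−1} ⋯ σ_{2,3} σ_{1,2}, i.e. the set {p ∈ BKL_n⁺ : p·q = δ_n for some q ∈ BKL_n⁺}, is finite of cardinality equal to the n-th Catalan number (2n)! / (n! (n+1)!). -/
/-- The set of relators for Artin's classical presentation of the braid group `Bₙ`:
generators `σ₁, …, σ_{n-1}` (indexed by `Fin (n-1)`), with relations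
`σᵢ σₖ = σₖ σᵢ` when `|i - k| ≥ 2` and `σᵢ σ_{i+1} σᵢ = σ_{i+1} σᵢ σ_{i+1}`. -/
def braidRels (n : ℕ) : Set (FreeGroup (Fin (n - 1))) :=
  {w | (∃ i k : Fin (n - 1), (i : ℕ) + 2 ≤ (k : ℕ) ∧
          w = FreeGroup.of i * FreeGroup.of k * (FreeGroup.of k * FreeGroup.of i)⁻¹) ∨
       (∃ i k : Fin (n - 1), (i : ℕ) + 1 = (k : ℕ) ∧
          w = FreeGroup.of i * FreeGroup.of k * FreeGroup.of i *
              (FreeGroup.of k * FreeGroup.of i * FreeGroup.of k)⁻¹)}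

/-- The braid group `Bₙ`, given by Artin's classical presentation. -/
abbrev BraidGroup (n : ℕ) : Type := PresentedGroup (braidRels n)

/-- The generator `σ_{i+1}` of `Bₙ` for a natural-number index `i < n - 1`
(junk value `1` otherwise). -/
def sigmaB (n : ℕ) (i : ℕ) : BraidGroup n :=
  if h : i < n - 1 then PresentedGroup.of (⟨i, h⟩ : Fin (n - 1)) else 1

/-- The band generator of `Bₙ` joining (0-indexed) strands `a < b`; in 1-indexed classical
notation, `σ_{s,t} = (σ_{t-1} ⋯ σ_{s+1}) σ_s (σ_{s+1}⁻¹ ⋯ σ_{t-1}⁻¹)` where `s = a+1`,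
`t = b+1`.  Defined recursively: `band a (a+1) = σ_{a+1}` and
`band a (b+1) = σ_{b+1} · band a b · σ_{b+1}⁻¹`. -/
def bandWord (n a : ℕ) : ℕ → BraidGroup n
  | 0 => 1
  | b + 1 => if b = a then sigmaB n a else sigmaB n b * bandWord n a b * (sigmaB n b)⁻¹

/-- Index set for the Birman–Ko–Lee generators: pairs of strands `s < t` (0-indexed). -/
abbrev BKLIdx (n : ℕ) : Type := {p : Fin n × Fin n // p.1 < p.2}
/-- The defining relations of the Birman–Ko–Lee monoid `BKLₙ⁺`:
`σ_{s,t} σ_{q,r} = σ_{q,r} σ_{s,t}` whenever `(t-r)(t-q)(s-r)(s-q) > 0`, and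
`σ_{s,t} σ_{r,s} = σ_{r,t} σ_{s,t} = σ_{r,s} σ_{r,t}` whenever `r < s < t`. -/
inductive BKLMonoidRel (n : ℕ) :
    FreeMonoid (BKLIdx n) → FreeMonoid (BKLIdx n) → Prop
  | comm (p q : BKLIdx n)
      (h : (((p.1.2 : ℕ) : ℤ) - ((q.1.2 : ℕ) : ℤ)) *
        (((p.1.2 : ℕ) : ℤ) - ((q.1.1 : ℕ) : ℤ)) *
        (((p.1.1 : ℕ) : ℤ) - ((q.1.2 : ℕ) : ℤ)) *
        (((p.1.1 : ℕ) : ℤ) - ((q.1.1 : ℕ) : ℤ)) > 0) :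
      BKLMonoidRel n (FreeMonoid.of p * FreeMonoid.of q)
        (FreeMonoid.of q * FreeMonoid.of p)
  | triangleA (r s t : Fin n) (hrs : r < s) (hst : s < t) :
      BKLMonoidRel n (FreeMonoid.of ⟨(s, t), hst⟩ * FreeMonoid.of ⟨(r, s), hrs⟩)
        (FreeMonoid.of ⟨(r, t), hrs.trans hst⟩ * FreeMonoid.of ⟨(s, t), hst⟩)
  | triangleB (r s t : Fin n) (hrs : r < s) (hst : s < t) :
      BKLMonoidRel n (FreeMonoid.of ⟨(s, t), hst⟩ * FreeMonoid.of ⟨(r, s), hrs⟩)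
        (FreeMonoid.of ⟨(r, s), hrs⟩ * FreeMonoid.of ⟨(r, t), hrs.trans hst⟩)

/-- The Birman–Ko–Lee monoid `BKLₙ⁺`. -/
abbrev BKLMonoid (n : ℕ) : Type := (conGen (BKLMonoidRel n)).Quotient

/-- The generator `σ_{s+1,t+1}` of `BKLₙ⁺` for natural-number strand indices
`s < t < n` (junk value `1` otherwise). -/
def bklGen (n s t : ℕ) : BKLMonoid n :=
  if h : s < t ∧ t < n then
    (conGen (BKLMonoidRel n)).mk'
      (FreeMonoid.of ⟨(⟨s, h.1.trans h.2⟩, ⟨t, h.2⟩), Fin.mk_lt_mk.mpr h.1⟩)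
  else 1

/-- The Birman–Ko–Lee Garside element `δₙ = σ_{n-1,n} σ_{n-2,n-1} ⋯ σ_{2,3} σ_{1,2}`
of `BKLₙ⁺` (written with 0-indexed strands). -/
def bklDelta (n : ℕ) : BKLMonoid n :=
  ((List.range (n - 1)).map fun j => bklGen n (n - 2 - j) (n - 1 - j)).prod

/-- A setoid on a linear order is noncrossing if no two distinct classes cross. -/
def IsNoncrossing {α : Type*} [LinearOrder α] (K : Setoid α) : Prop :=
  ∀ a b c d, a < b → b < c → c < d → K a c → K b d → K a b

/-- The refinement of a setoid obtained by separating the half-open interval `[x, y)` from its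
complement. -/
def cutSetoid {α : Type*} [LinearOrder α] (K : Setoid α) (x y : α) : Setoid α where
  r z w := K z w ∧ ((x ≤ z ∧ z < y) ↔ (x ≤ w ∧ w < y))
  iseqv := ⟨fun _ => ⟨K.refl _, Iff.rfl⟩, fun h => ⟨K.symm h.1, h.2.symm⟩,
    fun h h' => ⟨K.trans h.1 h'.1, h.2.trans h'.2⟩⟩

section Cut

variable {α : Type*} [LinearOrder α]

theorem cutSetoid_apply (K : Setoid α) (x y z w : α) :
    cutSetoid K x y z w ↔ K z w ∧ ((x ≤ z ∧ z < y) ↔ (x ≤ w ∧ w < y)) := Iff.rfl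

theorem cutSetoid_lt {K : Setoid α} {x y : α} (hxy : x < y) (h : K x y) :
    cutSetoid K x y < K := by
  refine lt_of_le_of_ne (fun z w hzw => hzw.1) fun he => ?_
  have h' : cutSetoid K x y x y := by rw [he]; exact h
  rw [cutSetoid_apply] at h'
  grind

theorem IsNoncrossing.related_of_separated {K : Setoid α} (hK : IsNoncrossing K) {x y z w : α}
    (h : K x y) (hzw : K z w) (hz : x ≤ z ∧ z < y) (hw : ¬ (x ≤ w ∧ w < y)) : K x z := by
  rcases hz.1.eq_or_lt with rfl | hxz
  · exact K.refl _
  rcases lt_or_ge w x with hwx | hwx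
  · exact K.symm (K.trans hzw (hK w x z y hwx hxz hz.2 (K.symm hzw) h))
  · have hyw : y ≤ w := by grind
    rcases hyw.eq_or_lt with rfl | hyw
    · exact K.trans h (K.symm hzw)
    · exact hK x z y w hxz hz.2 hyw h hzw

theorem cutSetoid_injective {K K' : Setoid α} (hK : IsNoncrossing K) (hK' : IsNoncrossing K')
    {x y : α} (hxy : x < y) (h : K x y) (h' : K' x y)
    (he : cutSetoid K x y = cutSetoid K' x y) : K = K' := by
  have key : ∀ K K' : Setoid α, IsNoncrossing K → K x y → K' x y →
      cutSetoid K x y = cutSetoid K' x y → K ≤ K' := by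
    intro K K' hK h h' he z w hzw
    have hiff : ∀ z w, cutSetoid K x y z w → K' z w := by
      intro z w hc
      rw [he] at hc
      exact hc.1
    have side : ∀ z w, K z w → (x ≤ z ∧ z < y) → ¬ (x ≤ w ∧ w < y) → K' z w := by
      intro z w hzw hz hw
      have hxz := hK.related_of_separated h hzw hz hw
      exact K'.trans (hiff z x ⟨K.symm hxz, by grind⟩)
        (K'.trans h' (hiff y w ⟨K.trans (K.symm h) (K.trans hxz hzw), by grind⟩))
    by_cases hz : x ≤ z ∧ z < y <;> by_cases hw : x ≤ w ∧ w < y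
    · exact hiff _ _ ⟨hzw, iff_of_true hz hw⟩
    · exact side z w hzw hz hw
    · exact K'.symm (side w z (K.symm hzw) hw hz)
    · exact hiff _ _ ⟨hzw, iff_of_false hz hw⟩
  exact le_antisymm (key K K' hK h h' he) (key K' K hK' h' h he.symm)

theorem IsNoncrossing.cut {K : Setoid α} (hK : IsNoncrossing K) {x y : α} :
    IsNoncrossing (cutSetoid K x y) := by
  intro a b c d hab hbc hcd hac hbd
  refine ⟨hK a b c d hab hbc hcd hac.1 hbd.1, ?_⟩
  have h1 := hac.2
  have h2 := hbd.2
  grind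

/-- Gluing the classes of the endpoints of a saturated interval `[x, y)`. -/
theorem IsNoncrossing.exists_cutSetoid_eq {K : Setoid α} (hK : IsNoncrossing K) {x y : α}
    (hxy : x < y) (hsat : ∀ z w, K z w → ((x ≤ z ∧ z < y) ↔ (x ≤ w ∧ w < y))) :
    ∃ K' : Setoid α, IsNoncrossing K' ∧ K' x y ∧ cutSetoid K' x y = K := by
  have hs : ∀ a b, K a b → K b a := fun _ _ h => K.symm h
  have ht : ∀ a b c, K a b → K b c → K a c := fun _ _ _ h h' => K.trans h h'
  let K' : Setoid α :=
    { r := fun z w => K z w ∨ ((K x z ∨ K y z) ∧ (K x w ∨ K y w))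
      iseqv := ⟨fun _ => Or.inl (K.refl _), by grind, by grind⟩ }
  have hK' : ∀ z w, K' z w ↔ K z w ∨ ((K x z ∨ K y z) ∧ (K x w ∨ K y w)) := fun _ _ => Iff.rfl
  refine ⟨K', ?_, Or.inr ⟨Or.inl (K.refl _), Or.inr (K.refl _)⟩, ?_⟩
  · intro a b c d hab hbc hcd hac hbd
    rw [hK'] at *
    have h1 : ∀ z, K x z → x ≤ z ∧ z < y := fun z h => (hsat x z h).1 ⟨le_rfl, hxy⟩
    have h2 : ∀ z, K y z → ¬ (x ≤ z ∧ z < y) := fun z h h' => by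
      have := (hsat y z h).2 h'
      grind
    by_cases hac' : K a c <;> by_cases hbd' : K b d
    · exact Or.inl (hK a b c d hab hbc hcd hac' hbd')
    · have hac2 := hsat a c hac'
      have hbd2 := hbd.resolve_left hbd'
      by_cases ha : (K x a ∨ K y a)
      · exact Or.inr ⟨ha, hbd2.1⟩
      have hxa : x ≠ a := by grind
      have hya : y ≠ a := by grind
      have hxc : x ≠ c := by grind
      have hyc : y ≠ c := by grind
      have := hK a b c x
      have := hK a b c y
      have := hK a x c d
      have := hK a y c d
      have := hK x a d c
      have := hK x a b c
      rcases hbd2 with ⟨hb | hb, hd | hd⟩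
      · grind
      · have := h1 b hb
        have := h2 d hd
        grind
      · have := h2 b hb
        have := h1 d hd
        grind
      · grind
    · have hbd2 := hsat b d hbd'
      have hac2 := hac.resolve_left hac'
      by_cases hb : (K x b ∨ K y b)
      · exact Or.inr ⟨hac2.1, hb⟩
      have := hK x b c d
      have := hK y b c d
      have := hK a x b d
      have := hK a b x d
      have := hK a b y d
      have hxb : x ≠ b := by grind
      have hyb : y ≠ b := by grind
      have hxd : x ≠ d := by grind
      have hyd : y ≠ d := by grind
      rcases hac2 with ⟨ha | ha, hc | hc⟩
      · grind
      · have := h1 a ha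
        have := h2 c hc
        have : y < b := by grind
        grind
      · have := h2 a ha
        have := h1 c hc
        by_cases hxb' : x < b
        · grind
        · grind
      · grind
    · grind
  · ext z w
    rw [cutSetoid_apply, hK']
    have h1 : ∀ z, K x z → x ≤ z ∧ z < y := fun z h => (hsat x z h).1 ⟨le_rfl, hxy⟩
    have h2 : ∀ z, K y z → ¬ (x ≤ z ∧ z < y) := fun z h h' => by
      have := (hsat y z h).2 h'
      grind
    have := hsat z w
    grind

theorem exists_saturated_of_ne_top {n : ℕ} {K : Setoid (Fin n)} (hK : IsNoncrossing K)
    (hne : K ≠ ⊤) : ∃ x y : Fin n, x < y ∧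
      ∀ z w, K z w → ((x ≤ z ∧ z < y) ↔ (x ≤ w ∧ w < y)) := by
  classical
  rcases n with _ | n
  · exact absurd (Setoid.ext fun a => a.elim0) hne
  obtain ⟨a, ha⟩ : ∃ a, ¬ K a (Fin.last n) := by
    by_contra! h
    exact hne (Setoid.ext fun z w => iff_of_true (K.trans (h z) (K.symm (h w))) trivial)
  let B : Finset (Fin (n + 1)) := Finset.univ.filter fun z => K a z
  have hB : B.Nonempty := ⟨a, by simp [B]⟩
  have hmin : K a (B.min' hB) := (Finset.mem_filter.1 (B.min'_mem hB)).2
  have hmax : K a (B.max' hB) := (Finset.mem_filter.1 (B.max'_mem hB)).2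
  have hle : ∀ z, K a z → B.min' hB ≤ z ∧ z ≤ B.max' hB := fun z hz =>
    ⟨B.min'_le z (by simp [B, hz]), B.le_max' z (by simp [B, hz])⟩
  generalize B.min' hB = x at *
  generalize B.max' hB = M at *
  have hM : M ≠ Fin.last n := by rintro rfl; exact ha hmax
  have hxM : x ≤ M := (hle x hmin).2
  have hM' : (M : ℕ) < n := Fin.val_lt_last hM
  have hside : ∀ z w, K z w → (x ≤ z ∧ z ≤ M) → (x ≤ w ∧ w ≤ M) := by
    intro z w hzw hz
    by_cases haz : K a z
    · exact hle w (K.trans haz hzw)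
    have hzx : z ≠ x := by rintro rfl; exact haz hmin
    have hzM : z ≠ M := by rintro rfl; exact haz hmax
    have hxz : x < z := lt_of_le_of_ne hz.1 hzx.symm
    have hzM : z < M := lt_of_le_of_ne hz.2 hzM
    have hxKM : K x M := K.trans (K.symm hmin) hmax
    by_contra hw
    rcases lt_or_ge w x with hwx | hwx
    · exact haz (K.trans hmin (K.trans (K.symm (hK w x z M hwx hxz hzM (K.symm hzw) hxKM))
        (K.symm hzw)))
    · have hMw : M < w := by grind
      exact haz (K.trans hmin (hK x z M w hxz hzM hMw hxKM hzw))
  refine ⟨x, ⟨M + 1, by omega⟩, Fin.lt_def.2 (by have := Fin.le_def.1 hxM; grind), fun z w hzw => ?_⟩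
  have e : ∀ z : Fin (n + 1), z < ⟨M + 1, by omega⟩ ↔ z ≤ M := fun z => by
    rw [Fin.lt_def, Fin.le_def]; exact Nat.lt_succ_iff
  rw [e, e]
  exact ⟨hside z w hzw, hside w z (K.symm hzw)⟩

end Cut

section Action

open Classical in
/-- The action of a Birman–Ko–Lee generator `σ_{x,y}` on setoids: it separates `[x, y)` from its
complement if `x` and `y` are related, and is undefined (`none`) otherwise. -/
noncomputable def cutEnd {n : ℕ} (g : BKLIdx n) : Function.End (Option (Setoid (Fin n))) :=
  fun o => o.bind fun K => if K g.1.1 g.1.2 then some (cutSetoid K g.1.1 g.1.2) else none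

variable {n : ℕ}

theorem cutEnd_none (g : BKLIdx n) : cutEnd g none = none := rfl

theorem cutEnd_some_of_rel {g : BKLIdx n} {K : Setoid (Fin n)} (h : K g.1.1 g.1.2) :
    cutEnd g (some K) = some (cutSetoid K g.1.1 g.1.2) := by
  simp [cutEnd, h]

theorem cutEnd_eq_some {g : BKLIdx n} {K M : Setoid (Fin n)} :
    cutEnd g (some K) = some M ↔ K g.1.1 g.1.2 ∧ cutSetoid K g.1.1 g.1.2 = M := by
  simp [cutEnd]

theorem cutEnd_comp_eq_some {g h : BKLIdx n} {K M : Setoid (Fin n)} :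
    (cutEnd g * cutEnd h) (some K) = some M ↔ K h.1.1 h.1.2 ∧
      cutSetoid K h.1.1 h.1.2 g.1.1 g.1.2 ∧
      cutSetoid (cutSetoid K h.1.1 h.1.2) g.1.1 g.1.2 = M := by
  change cutEnd g (cutEnd h (some K)) = some M ↔ _
  by_cases hK : K h.1.1 h.1.2
  · rw [cutEnd_some_of_rel hK, cutEnd_eq_some]
    simp [hK]
  · have : cutEnd h (some K) = none := by simp [cutEnd, hK]
    rw [this, cutEnd_none]
    simp [hK]

theorem cutEnd_mul_eq {g h g' h' : BKLIdx n}
    (H : ∀ K : Setoid (Fin n),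
      ((K h.1.1 h.1.2 ∧ cutSetoid K h.1.1 h.1.2 g.1.1 g.1.2) ↔
        (K h'.1.1 h'.1.2 ∧ cutSetoid K h'.1.1 h'.1.2 g'.1.1 g'.1.2)) ∧
      (K h.1.1 h.1.2 → cutSetoid K h.1.1 h.1.2 g.1.1 g.1.2 →
        cutSetoid (cutSetoid K h.1.1 h.1.2) g.1.1 g.1.2 =
          cutSetoid (cutSetoid K h'.1.1 h'.1.2) g'.1.1 g'.1.2)) :
    cutEnd g * cutEnd h = cutEnd g' * cutEnd h' := by
  funext o
  rcases o with _ | K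
  · rfl
  · refine Option.ext fun M => ?_
    rw [cutEnd_comp_eq_some, cutEnd_comp_eq_some]
    obtain ⟨h1, h2⟩ := H K
    grind

theorem cutEnd_rel {u v : FreeMonoid (BKLIdx n)} (h : BKLMonoidRel n u v) :
    FreeMonoid.lift cutEnd u = FreeMonoid.lift cutEnd v := by
  rcases h with ⟨p, q, h⟩ | ⟨r, s, t, hrs, hst⟩ | ⟨r, s, t, hrs, hst⟩ <;>
    simp only [map_mul, FreeMonoid.lift_eval_of] <;>
    refine cutEnd_mul_eq fun K => ?_
  · obtain ⟨⟨S, T⟩, hST⟩ := p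
    obtain ⟨⟨Q, R⟩, hQR⟩ := q
    simp only [gt_iff_lt, mul_pos_iff, mul_neg_iff] at h
    simp only at hST hQR
    have hcases : T < Q ∨ R < S ∨ (Q < S ∧ T < R) ∨ (S < Q ∧ R < T) := by omega
    refine ⟨?_, fun _ _ => Setoid.ext fun z w => ?_⟩ <;> simp only [cutSetoid_apply] <;> grind
  · have hr : ∀ a, K a a := fun a => K.refl a
    have hs : ∀ a b, K a b → K b a := fun _ _ h => K.symm h
    have ht : ∀ a b c, K a b → K b c → K a c := fun _ _ _ h h' => K.trans h h'
    refine ⟨?_, fun _ _ => Setoid.ext fun z w => ?_⟩ <;> simp only [cutSetoid_apply] <;> grind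
  · have hr : ∀ a, K a a := fun a => K.refl a
    have hs : ∀ a b, K a b → K b a := fun _ _ h => K.symm h
    have ht : ∀ a b c, K a b → K b c → K a c := fun _ _ _ h h' => K.trans h h'
    refine ⟨?_, fun _ _ => Setoid.ext fun z w => ?_⟩ <;> simp only [cutSetoid_apply] <;> grind

/-- The action of the Birman–Ko–Lee monoid on partially defined setoids by cutting. -/
noncomputable def cutHom (n : ℕ) : BKLMonoid n →* Function.End (Option (Setoid (Fin n))) :=
  Con.lift _ (FreeMonoid.lift cutEnd) (Con.conGen_le.2 fun _ _ h => cutEnd_rel h)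

/-- The image in the Birman–Ko–Lee monoid of a generator. -/
def bklOf (g : BKLIdx n) : BKLMonoid n := (conGen (BKLMonoidRel n)).mk' (FreeMonoid.of g)

theorem cutHom_bklOf (g : BKLIdx n) : cutHom n (bklOf g) = cutEnd g := by
  simp [cutHom, bklOf]

theorem bkl_induction {P : BKLMonoid n → Prop} (one : P 1)
    (mul : ∀ p g, P p → P (p * bklOf g)) (p : BKLMonoid n) : P p := by
  have key : ∀ (w : FreeMonoid (BKLIdx n)) (q : BKLMonoid n), P q →
      P (q * (conGen (BKLMonoidRel n)).mk' w) := by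
    intro w
    induction w using FreeMonoid.inductionOn with
    | one => intro q hq; simpa using hq
    | of g => exact fun q hq => mul q g hq
    | mul u v hu hv =>
      intro q hq
      rw [map_mul, ← mul_assoc]
      exact hv _ (hu _ hq)
  obtain ⟨w, rfl⟩ := Con.mk'_surjective p
  simpa using key w 1 one

theorem bkl_cases_mul (p : BKLMonoid n) : p = 1 ∨ ∃ p' g, p = p' * bklOf g := by
  induction p using bkl_induction with
  | one => exact Or.inl rfl
  | mul p g _ => exact Or.inr ⟨p, g, rfl⟩

theorem cutHom_none (p : BKLMonoid n) : cutHom n p none = none := by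
  induction p using bkl_induction with
  | one => rw [map_one]; rfl
  | mul p g ih => rw [map_mul, cutHom_bklOf]; exact ih

theorem cutHom_mul_bklOf_eq_some {p : BKLMonoid n} {g : BKLIdx n} {K M : Setoid (Fin n)} :
    cutHom n (p * bklOf g) (some K) = some M ↔
      K g.1.1 g.1.2 ∧ cutHom n p (some (cutSetoid K g.1.1 g.1.2)) = some M := by
  rw [map_mul, cutHom_bklOf]
  change cutHom n p (cutEnd g (some K)) = some M ↔ _
  by_cases hK : K g.1.1 g.1.2
  · simp [cutEnd_some_of_rel hK, hK]
  · have hn : cutEnd g (some K) = none := by simp [cutEnd, hK]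
    simp [hn, cutHom_none, hK]

theorem cutHom_one_eq_some {K M : Setoid (Fin n)} :
    cutHom n 1 (some K) = some M ↔ K = M := by
  rw [map_one]
  exact Option.some_inj

theorem cutHom_mul_apply (p q : BKLMonoid n) (o : Option (Setoid (Fin n))) :
    cutHom n (p * q) o = cutHom n p (cutHom n q o) := by
  rw [map_mul]; rfl

theorem IsNoncrossing.of_cutHom {p : BKLMonoid n} {K M : Setoid (Fin n)} (hK : IsNoncrossing K)
    (h : cutHom n p (some K) = some M) : IsNoncrossing M := by
  induction p using bkl_induction generalizing K with
  | one => rwa [← cutHom_one_eq_some.1 h]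
  | mul p g ih => exact ih hK.cut (cutHom_mul_bklOf_eq_some.1 h).2

theorem cutHom_injective {p : BKLMonoid n} {K K' M : Setoid (Fin n)} (hK : IsNoncrossing K)
    (hK' : IsNoncrossing K') (h : cutHom n p (some K) = some M)
    (h' : cutHom n p (some K') = some M) : K = K' := by
  induction p using bkl_induction generalizing K K' with
  | one => rw [cutHom_one_eq_some.1 h, cutHom_one_eq_some.1 h']
  | mul p g ih =>
    rw [cutHom_mul_bklOf_eq_some] at h h'
    exact cutSetoid_injective hK hK' g.2 h.1 h'.1 (ih hK.cut hK'.cut h.2 h'.2)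

theorem bklOf_mul_comm {p q : BKLIdx n} (h : p.1.2 < q.1.1 ∨ q.1.2 < p.1.1 ∨
    (p.1.1 < q.1.1 ∧ q.1.2 < p.1.2) ∨ (q.1.1 < p.1.1 ∧ p.1.2 < q.1.2)) :
    bklOf p * bklOf q = bklOf q * bklOf p := by
  rw [bklOf, bklOf, ← map_mul, ← map_mul]
  refine (Con.eq _).2 (ConGen.Rel.of _ _ (.comm p q ?_))
  obtain ⟨⟨S, T⟩, hST⟩ := p
  obtain ⟨⟨Q, R⟩, hQR⟩ := q
  simp only [gt_iff_lt, mul_pos_iff, mul_neg_iff]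
  simp only at hST hQR h
  omega

theorem bklOf_triangle {r s t : Fin n} (hrs : r < s) (hst : s < t) :
    bklOf ⟨(s, t), hst⟩ * bklOf ⟨(r, s), hrs⟩ =
      bklOf ⟨(r, t), hrs.trans hst⟩ * bklOf ⟨(s, t), hst⟩ ∧
    bklOf ⟨(s, t), hst⟩ * bklOf ⟨(r, s), hrs⟩ =
      bklOf ⟨(r, s), hrs⟩ * bklOf ⟨(r, t), hrs.trans hst⟩ := by
  simp only [bklOf, ← map_mul]
  exact ⟨(Con.eq _).2 (ConGen.Rel.of _ _ (.triangleA r s t hrs hst)),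
    (Con.eq _).2 (ConGen.Rel.of _ _ (.triangleB r s t hrs hst))⟩

instance finite_setoid {α : Type*} [Finite α] : Finite (Setoid α) :=
  Finite.of_injective (fun K : Setoid α => (K : α → α → Prop)) fun _ _ h =>
    Setoid.ext fun a b => iff_of_eq (congrFun (congrFun h a) b)

theorem exists_cutHom_eq_bot (K : Setoid (Fin n)) : ∃ p, cutHom n p (some K) = some ⊥ := by
  induction K using WellFoundedLT.induction with
  | ind K ih =>
    by_cases hK : ∃ x y, x < y ∧ K x y
    · obtain ⟨x, y, hxy, h⟩ := hK
      obtain ⟨p, hp⟩ := ih _ (cutSetoid_lt hxy h)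
      exact ⟨p * bklOf ⟨(x, y), hxy⟩, cutHom_mul_bklOf_eq_some.2 ⟨h, hp⟩⟩
    · refine ⟨1, cutHom_one_eq_some.2 (eq_bot_iff.2 fun x y h => ?_)⟩
      by_contra hne
      rcases lt_or_gt_of_ne hne with hlt | hlt
      · exact hK ⟨x, y, hlt, h⟩
      · exact hK ⟨y, x, hlt, K.symm h⟩

theorem exists_cutHom_top_eq {K : Setoid (Fin n)} (hK : IsNoncrossing K) :
    ∃ q, cutHom n q (some ⊤) = some K := by
  induction K using WellFoundedGT.induction with
  | ind K ih =>
    by_cases hne : K = ⊤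
    · exact ⟨1, cutHom_one_eq_some.2 hne.symm⟩
    · obtain ⟨x, y, hxy, hsat⟩ := exists_saturated_of_ne_top hK hne
      obtain ⟨K', hK', h, rfl⟩ := hK.exists_cutSetoid_eq hxy hsat
      obtain ⟨q, hq⟩ := ih K' (cutSetoid_lt hxy h) hK'
      refine ⟨bklOf ⟨(x, y), hxy⟩ * q, ?_⟩
      rw [cutHom_mul_apply, hq, cutHom_bklOf]
      exact cutEnd_some_of_rel h

theorem eq_of_cutHom_eq_bot {p p' : BKLMonoid n} {K : Setoid (Fin n)} (hK : IsNoncrossing K)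
    (hp : cutHom n p (some K) = some ⊥) (hp' : cutHom n p' (some K) = some ⊥) : p = p' := by
  induction K using WellFoundedLT.induction generalizing p p' with
  | ind K ih =>
  choose G hG using exists_cutHom_eq_bot (n := n)
  let E : BKLIdx n → BKLMonoid n := fun g => G (cutSetoid K g.1.1 g.1.2) * bklOf g
  have hE : ∀ g p, K g.1.1 g.1.2 → cutHom n p (some (cutSetoid K g.1.1 g.1.2)) = some ⊥ →
      p * bklOf g = E g := fun g p hg h =>
    congrArg (· * bklOf g) (ih _ (cutSetoid_lt g.2 hg) hK.cut h (hG _))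
  have hE2 : ∀ g h : BKLIdx n, K h.1.1 h.1.2 → cutSetoid K h.1.1 h.1.2 g.1.1 g.1.2 →
      E h = G (cutSetoid (cutSetoid K h.1.1 h.1.2) g.1.1 g.1.2) * (bklOf g * bklOf h) := by
    intro g h hh hg
    rw [← mul_assoc, hE h _ hh (cutHom_mul_bklOf_eq_some.2 ⟨hg, hG _⟩)]
  have hcomm : ∀ g h : BKLIdx n, K g.1.1 g.1.2 → K h.1.1 h.1.2 →
      (g.1.2 < h.1.1 ∨ h.1.2 < g.1.1 ∨ (g.1.1 < h.1.1 ∧ h.1.2 < g.1.2) ∨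
        (h.1.1 < g.1.1 ∧ g.1.2 < h.1.2)) → E g = E h := by
    intro g h hg hh hgh
    have h1 := g.2
    have h2 := h.2
    rw [hE2 g h hh ⟨hg, by grind⟩, hE2 h g hg ⟨hh, by grind⟩, bklOf_mul_comm hgh]
    congr 2
    refine Setoid.ext fun z w => ?_
    simp only [cutSetoid_apply]
    grind
  have htri : ∀ r s t (hrs : r < s) (hst : s < t), K r s → K s t →
      E ⟨(r, s), hrs⟩ = E ⟨(s, t), hst⟩ ∧ E ⟨(r, s), hrs⟩ = E ⟨(r, t), hrs.trans hst⟩ := by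
    intro r s t hrs hst h1 h2
    have h3 := K.trans h1 h2
    obtain ⟨t1, t2⟩ := bklOf_triangle hrs hst
    rw [hE2 ⟨(s, t), hst⟩ ⟨(r, s), hrs⟩ h1 ⟨h2, by grind⟩,
      hE2 ⟨(r, t), hrs.trans hst⟩ ⟨(s, t), hst⟩ h2 ⟨h3, by grind⟩,
      hE2 ⟨(r, s), hrs⟩ ⟨(r, t), hrs.trans hst⟩ h3 ⟨h1, by grind⟩, ← t1, ← t2]
    constructor <;> congr 2 <;> refine Setoid.ext fun z w => ?_ <;>
      simp only [cutSetoid_apply] <;> grind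
  have hcross : ∀ a b c d (hab : a < b) (hbc : b < c) (hcd : c < d), K a c → K b d →
      E ⟨(a, c), hab.trans hbc⟩ = E ⟨(b, d), hbc.trans hcd⟩ := by
    intro a b c d hab hbc hcd hac hbd
    have h := hK a b c d hab hbc hcd hac hbd
    rw [← (htri a b c hab hbc h (K.trans (K.symm h) hac)).2,
      (htri a b d hab (hbc.trans hcd) h hbd).1]
  have hall : ∀ g h : BKLIdx n, K g.1.1 g.1.2 → K h.1.1 h.1.2 → E g = E h := by
    rintro ⟨⟨x, y⟩, hxy⟩ ⟨⟨u, v⟩, huv⟩ hg hh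
    simp only at hxy huv hg hh
    rcases lt_trichotomy x u with h1 | rfl | h1
    · rcases lt_trichotomy y u with h2 | rfl | h2
      · exact hcomm _ _ hg hh (by grind)
      · exact (htri x y v hxy huv hg hh).1
      · rcases lt_trichotomy y v with h3 | rfl | h3
        · exact hcross x u y v h1 h2 h3 hg hh
        · have := htri x u y h1 huv (K.trans hg (K.symm hh)) hh
          rw [← this.1, this.2]
        · exact hcomm _ _ hg hh (by grind)
    · rcases lt_trichotomy y v with h3 | rfl | h3
      · exact (htri x y v hxy h3 hg (K.trans (K.symm hg) hh)).2
      · rfl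
      · exact (htri x v y huv h3 hh (K.trans (K.symm hh) hg)).2.symm
    · rcases lt_trichotomy v x with h2 | rfl | h2
      · exact hcomm _ _ hg hh (by grind)
      · exact (htri u v y huv hxy hh hg).1.symm
      · rcases lt_trichotomy v y with h3 | rfl | h3
        · exact (hcross u x v y h1 h2 h3 hh hg).symm
        · have := htri u x v h1 hxy (K.trans hh (K.symm hg)) hg
          rw [← this.1, this.2]
        · exact hcomm _ _ hg hh (by grind)
  have hform : ∀ p, cutHom n p (some K) = some ⊥ →
      (p = 1 ∧ K = ⊥) ∨ ∃ g, K g.1.1 g.1.2 ∧ p = E g := by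
    intro p hp
    rcases bkl_cases_mul p with rfl | ⟨p', g, rfl⟩
    · exact Or.inl ⟨rfl, cutHom_one_eq_some.1 hp⟩
    · obtain ⟨h1, h2⟩ := cutHom_mul_bklOf_eq_some.1 hp
      exact Or.inr ⟨g, h1, hE g p' h1 h2⟩
  have hbot : ∀ g : BKLIdx n, K g.1.1 g.1.2 → K ≠ ⊥ := by
    rintro g hg rfl
    exact g.2.ne hg
  rcases hform p hp with ⟨rfl, h⟩ | ⟨g, hg, rfl⟩ <;>
    rcases hform p' hp' with ⟨rfl, h'⟩ | ⟨g', hg', rfl⟩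
  · rfl
  · exact absurd h (hbot g' hg')
  · exact absurd h' (hbot g hg)
  · exact hall g g' hg hg'

/-- The setoid whose only nontrivial class is `{k, k + 1, …}`. -/
def tailSetoid (n k : ℕ) : Setoid (Fin n) where
  r z w := z = w ∨ (k ≤ (z : ℕ) ∧ k ≤ (w : ℕ))
  iseqv := ⟨by grind, by grind, by grind⟩

theorem cutHom_bklDelta (n : ℕ) : cutHom n (bklDelta n) (some ⊤) = some ⊥ := by
  have key : ∀ m ≤ n - 1, cutHom n
      ((List.range m).map fun j => bklGen n (m - 1 - j) (m - j)).prod (some ⊤) =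
        some (tailSetoid n m) := by
    intro m
    induction m with
    | zero =>
      intro _
      rw [List.range_zero, List.map_nil, List.prod_nil, cutHom_one_eq_some]
      exact Setoid.ext fun z w => iff_of_true trivial (Or.inr ⟨Nat.zero_le _, Nat.zero_le _⟩)
    | succ m ih =>
      intro hm
      rw [List.range_succ_eq_map, List.map_cons, List.prod_cons, List.map_map, cutHom_mul_apply]
      have hf : ((fun j => bklGen n (m + 1 - 1 - j) (m + 1 - j)) ∘ Nat.succ) =
          fun j => bklGen n (m - 1 - j) (m - j) := by
        funext j
        simp only [Function.comp_apply]
        congr 1 <;> omega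
      rw [hf, ih (by omega)]
      have hgen : bklGen n (m + 1 - 1 - 0) (m + 1 - 0) =
          bklOf ⟨(⟨m, by omega⟩, ⟨m + 1, by omega⟩), Fin.mk_lt_mk.mpr (by omega)⟩ := by
        simp [bklGen, bklOf, show m + 1 < n by omega]
      rw [hgen, cutHom_bklOf, cutEnd_eq_some]
      refine ⟨Or.inr ⟨le_rfl, Nat.le_succ _⟩, Setoid.ext fun z w => ?_⟩
      simp only [cutSetoid_apply, Fin.le_def, Fin.lt_def]
      change (z = w ∨ (m ≤ (z : ℕ) ∧ m ≤ (w : ℕ))) ∧ _ ↔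
        (z = w ∨ (m + 1 ≤ (z : ℕ) ∧ m + 1 ≤ (w : ℕ)))
      grind
  have h := key (n - 1) le_rfl
  have hbot : tailSetoid n (n - 1) = ⊥ := by
    refine Setoid.ext fun z w => ⟨?_, Or.inl⟩
    rintro (h | ⟨h1, h2⟩)
    · exact h
    · exact Fin.ext (by omega)
  rw [hbot] at h
  have hlist : bklDelta n =
      ((List.range (n - 1)).map fun j => bklGen n (n - 1 - 1 - j) (n - 1 - j)).prod := by
    simp only [bklDelta, Nat.sub_sub, Nat.reduceAdd]
  rw [hlist, h]

theorem isNoncrossing_top {α : Type*} [LinearOrder α] : IsNoncrossing (⊤ : Setoid α) :=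
  fun _ _ _ _ _ _ _ _ _ => trivial

/-- Left divisors of `δₙ` correspond to noncrossing setoids on `Fin n`. -/
theorem exists_noncrossing_equiv_divisors (n : ℕ) :
    Nonempty ({K : Setoid (Fin n) // IsNoncrossing K} ≃
      {p : BKLMonoid n | ∃ q : BKLMonoid n, p * q = bklDelta n}) := by
  choose G hG using exists_cutHom_eq_bot (n := n)
  have hmem : ∀ K : {K : Setoid (Fin n) // IsNoncrossing K},
      ∃ q, G K.1 * q = bklDelta n := by
    rintro ⟨K, hK⟩
    obtain ⟨q, hq⟩ := exists_cutHom_top_eq hK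
    exact ⟨q, eq_of_cutHom_eq_bot isNoncrossing_top
      (by rw [cutHom_mul_apply, hq, hG]) (cutHom_bklDelta n)⟩
  refine ⟨Equiv.ofBijective (fun K => ⟨G K.1, hmem K⟩) ⟨?_, ?_⟩⟩
  · rintro ⟨K, hK⟩ ⟨K', hK'⟩ h
    have h' : G K = G K' := congrArg Subtype.val h
    exact Subtype.ext (cutHom_injective hK hK' (hG K) (h' ▸ hG K'))
  · rintro ⟨p, q, hpq⟩
    have h := cutHom_bklDelta n
    rw [← hpq, cutHom_mul_apply] at h
    rcases hq : cutHom n q (some ⊤) with _ | K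
    · rw [hq, cutHom_none] at h
      exact absurd h (by simp)
    · rw [hq] at h
      have hK := isNoncrossing_top.of_cutHom hq
      exact ⟨⟨K, hK⟩, Subtype.ext (eq_of_cutHom_eq_bot hK (hG K) h)⟩

end Action

section Counting

/-- Noncrossing setoids on `ℕ` whose nontrivial classes lie in `[a, b)`. -/
def noncrossingOn (a b : ℕ) : Set (Setoid ℕ) :=
  {K | IsNoncrossing K ∧ ∀ z w, K z w → z ≠ w → a ≤ z ∧ z < b ∧ a ≤ w ∧ w < b}

/-- The setoid agreeing with `K` on `[c, d)` and trivial elsewhere. -/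
def restrictSetoid (K : Setoid ℕ) (c d : ℕ) : Setoid ℕ where
  r z w := z = w ∨ (K z w ∧ c ≤ z ∧ z < d ∧ c ≤ w ∧ w < d)
  iseqv := by
    have hs : ∀ a b, K a b → K b a := fun _ _ h => K.symm h
    have ht : ∀ a b c, K a b → K b c → K a c := fun _ _ _ h h' => K.trans h h'
    exact ⟨fun _ => Or.inl rfl, by grind, by grind⟩

theorem restrictSetoid_apply (K : Setoid ℕ) (c d z w : ℕ) :
    restrictSetoid K c d z w ↔ z = w ∨ (K z w ∧ c ≤ z ∧ z < d ∧ c ≤ w ∧ w < d) := Iff.rfl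

theorem restrictSetoid_mem {K : Setoid ℕ} (hK : IsNoncrossing K) (c d : ℕ) :
    restrictSetoid K c d ∈ noncrossingOn c d := by
  refine ⟨fun x y z w hxy hyz hzw hxz hyw => ?_, fun z w h hne => ?_⟩
  · rw [restrictSetoid_apply] at *
    have := hK x y z w
    grind
  · rw [restrictSetoid_apply] at h
    grind

/-- The setoid generated by `K₁` on `[a, j)`, by `K₂` on `[j + 1, b)`, and by relating `a`
to `j`. -/
def glueSetoid {a j b : ℕ} (haj : a ≤ j) (K₁ : noncrossingOn a j) (K₂ : noncrossingOn (j + 1) b) :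
    Setoid ℕ where
  r z w := K₁.1 (if z = j then a else z) (if w = j then a else w) ∨ K₂.1 z w
  iseqv := by
    obtain ⟨K₁, -, h₁⟩ := K₁
    obtain ⟨K₂, -, h₂⟩ := K₂
    have hr₁ : ∀ a, K₁ a a := fun a => K₁.refl a
    have hs₁ : ∀ a b, K₁ a b → K₁ b a := fun _ _ h => K₁.symm h
    have ht₁ : ∀ a b c, K₁ a b → K₁ b c → K₁ a c := fun _ _ _ h h' => K₁.trans h h'
    have hs₂ : ∀ a b, K₂ a b → K₂ b a := fun _ _ h => K₂.symm h
    have ht₂ : ∀ a b c, K₂ a b → K₂ b c → K₂ a c := fun _ _ _ h h' => K₂.trans h h'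
    refine ⟨fun _ => Or.inl (hr₁ _), by grind, ?_⟩
    intro x y z hxy hyz
    have := h₁ (if x = j then a else x) (if y = j then a else y)
    have := h₁ (if y = j then a else y) (if z = j then a else z)
    have := h₂ x y
    have := h₂ y z
    by_cases x = y
    · grind
    by_cases y = z
    · grind
    grind

variable {a j b : ℕ} {haj : a ≤ j} {K₁ : noncrossingOn a j} {K₂ : noncrossingOn (j + 1) b}

theorem glueSetoid_apply {z w : ℕ} : glueSetoid haj K₁ K₂ z w ↔
    K₁.1 (if z = j then a else z) (if w = j then a else w) ∨ K₂.1 z w := Iff.rfl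

theorem glueSetoid_left {z w : ℕ} (hz : z < j) (hw : w < j) :
    glueSetoid haj K₁ K₂ z w ↔ K₁.1 z w := by
  rw [glueSetoid_apply, if_neg hz.ne, if_neg hw.ne]
  have := K₂.2.2 z w
  have : K₁.1 z z := K₁.1.refl z
  grind

theorem glueSetoid_right {z w : ℕ} (hz : j < z) (hw : j < w) :
    glueSetoid haj K₁ K₂ z w ↔ K₂.1 z w := by
  rw [glueSetoid_apply, if_neg hz.ne', if_neg hw.ne']
  have := K₁.2.2 z w
  have : K₂.1 z z := K₂.1.refl z
  grind

theorem glueSetoid_le {z w : ℕ} (hzw : glueSetoid haj K₁ K₂ z w) (hz : z ≤ j) : w ≤ j := by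
  rw [glueSetoid_apply] at hzw
  have := K₁.2.2 (if z = j then a else z) (if w = j then a else w)
  have := K₂.2.2 z w
  grind

theorem glueSetoid_endpoints : glueSetoid haj K₁ K₂ a j :=
  Or.inl (by simp only [if_true]; split_ifs <;> exact K₁.1.refl _)

theorem glueSetoid_support (hjb : j < b) {z w : ℕ} (hzw : glueSetoid haj K₁ K₂ z w)
    (hne : z ≠ w) : a ≤ z ∧ z < b ∧ a ≤ w ∧ w < b := by
  rw [glueSetoid_apply] at hzw
  have := K₁.2.2 (if z = j then a else z) (if w = j then a else w)
  have := K₂.2.2 z w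
  grind

theorem glueSetoid_mem (hjb : j < b) : glueSetoid haj K₁ K₂ ∈ noncrossingOn a b := by
  refine ⟨fun x y z w hxy hyz hzw hxz hyw => ?_, fun z w h hne => glueSetoid_support hjb h hne⟩
  set K := glueSetoid haj K₁ K₂ with hKdef
  have hK : ∀ x y z w, x < y → y < z → z < w → w < j → K x z → K y w → K x y := by
    intro x y z w hxy hyz hzw hw hxz hyw
    rw [hKdef, glueSetoid_left (by omega) (by omega)] at hxz hyw ⊢
    exact K₁.2.1 x y z w hxy hyz hzw hxz hyw
  rcases lt_or_ge j x with hx | hx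
  · rw [hKdef, glueSetoid_right (by omega) (by omega)] at hxz hyw ⊢
    exact K₂.2.1 x y z w hxy hyz hzw hxz hyw
  have hz : z ≤ j := glueSetoid_le hxz hx
  have hw : w ≤ j := glueSetoid_le hyw (by omega)
  rcases hw.lt_or_eq with hw | rfl
  · exact hK x y z w hxy hyz hzw hw hxz hyw
  have haw : K a w := glueSetoid_endpoints
  have hay : K a y := K.trans haw (K.symm hyw)
  have hax : a ≤ x := (glueSetoid_support hjb hxz (by omega)).1
  rcases hax.eq_or_lt with rfl | hax
  · exact hay
  · exact K.trans (K.symm (hK a x y z hax hxy hyz hzw hay hxz)) hay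

theorem restrictSetoid_glueSetoid_left : restrictSetoid (glueSetoid haj K₁ K₂) a j = K₁.1 := by
  refine Setoid.ext fun z w => ?_
  rw [restrictSetoid_apply]
  have := K₁.2.2 z w
  have : K₁.1 z z := K₁.1.refl z
  have := @glueSetoid_left a j b haj K₁ K₂ z w
  grind

theorem restrictSetoid_glueSetoid_right :
    restrictSetoid (glueSetoid haj K₁ K₂) (j + 1) b = K₂.1 := by
  refine Setoid.ext fun z w => ?_
  rw [restrictSetoid_apply]
  have := K₂.2.2 z w
  have : K₂.1 z z := K₂.1.refl z
  have := @glueSetoid_right a j b haj K₁ K₂ z w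
  grind

theorem glueSetoid_restrictSetoid {K : Setoid ℕ} (hK : K ∈ noncrossingOn a b) (haj : a ≤ j)
    (h : K a j) (hmax : ∀ i, K a i → i ≤ j) :
    glueSetoid haj ⟨restrictSetoid K a j, restrictSetoid_mem hK.1 a j⟩
      ⟨restrictSetoid K (j + 1) b, restrictSetoid_mem hK.1 (j + 1) b⟩ = K := by
  refine Setoid.ext fun z w => ?_
  rw [glueSetoid_apply]
  simp only [restrictSetoid_apply]
  have hr : ∀ a, K a a := fun a => K.refl a
  have hs : ∀ a b, K a b → K b a := fun _ _ h => K.symm h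
  have ht : ∀ a b c, K a b → K b c → K a c := fun _ _ _ h h' => K.trans h h'
  have side : ∀ z w, K z w → a ≤ z → z ≤ j → w ≤ j := by
    intro z w hzw hz hzj
    by_contra! hw
    have := hK.1 a z j w
    grind
  have := hK.2 z w
  have := side z w
  have := side w z
  grind

/-- Decomposition of a noncrossing setoid at the largest element of the class of the least
point. -/
theorem exists_noncrossingOn_succ_equiv (a m : ℕ) :
    Nonempty ((Σ i : Fin (m + 1), noncrossingOn a (a + i) ×
      noncrossingOn (a + i + 1) (a + m + 1)) ≃ noncrossingOn a (a + m + 1)) := by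
  refine ⟨Equiv.ofBijective (fun x => ⟨glueSetoid (Nat.le_add_right a x.1) x.2.1 x.2.2,
    glueSetoid_mem (by omega)⟩) ⟨?_, ?_⟩⟩
  · rintro ⟨i, K₁, K₂⟩ ⟨i', K₁', K₂'⟩ h
    have h' : glueSetoid (Nat.le_add_right a i) K₁ K₂ =
      glueSetoid (Nat.le_add_right a i') K₁' K₂' := congrArg Subtype.val h
    have hi : i = i' := by
      have h1 : glueSetoid (Nat.le_add_right a i') K₁' K₂' a (a + i) :=
        h' ▸ glueSetoid_endpoints
      have h2 : glueSetoid (Nat.le_add_right a i) K₁ K₂ a (a + i') :=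
        h' ▸ glueSetoid_endpoints
      have := glueSetoid_le h1 (by omega)
      have := glueSetoid_le h2 (by omega)
      omega
    subst hi
    have e₁ : K₁ = K₁' := Subtype.ext (by
      rw [← restrictSetoid_glueSetoid_left (haj := Nat.le_add_right a i) (K₁ := K₁) (K₂ := K₂), h',
        restrictSetoid_glueSetoid_left])
    have e₂ : K₂ = K₂' := Subtype.ext (by
      rw [← restrictSetoid_glueSetoid_right (haj := Nat.le_add_right a i) (K₁ := K₁) (K₂ := K₂), h',
        restrictSetoid_glueSetoid_right])
    rw [e₁, e₂]
  · rintro ⟨K, hK⟩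
    have hbd : ∀ i, K a i → a ≤ i ∧ i ≤ a + m := by
      intro i hi
      have := hK.2 a i hi
      grind
    classical
    have hspec := Nat.findGreatest_spec (P := fun i => K a i) (n := a + m)
      (Nat.le_add_right a m) (K.refl a)
    have hmax : ∀ i, K a i → i ≤ Nat.findGreatest (fun i => K a i) (a + m) := fun i hi =>
      Nat.le_findGreatest (hbd i hi).2 hi
    generalize Nat.findGreatest (fun i => K a i) (a + m) = j at *
    obtain ⟨i, rfl⟩ := Nat.exists_eq_add_of_le (hbd j hspec).1
    have hi : i < m + 1 := by have := (hbd _ hspec).2; omega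
    exact ⟨⟨⟨i, hi⟩, ⟨_, restrictSetoid_mem hK.1 _ _⟩, ⟨_, restrictSetoid_mem hK.1 _ _⟩⟩,
      Subtype.ext (glueSetoid_restrictSetoid hK (Nat.le_add_right a i) hspec hmax)⟩

theorem card_noncrossingOn (m a : ℕ) :
    Finite (noncrossingOn a (a + m)) ∧ Nat.card (noncrossingOn a (a + m)) = catalan m := by
  induction m using Nat.strong_induction_on generalizing a with
  | _ m ih =>
  rcases m with _ | m
  · have hu : noncrossingOn a (a + 0) = {⊥} := by
      refine Set.eq_singleton_iff_unique_mem.2 ⟨⟨?_, ?_⟩, fun K hK => ?_⟩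
      · intro x y z w hxy hyz hzw hxz
        have : x = z := hxz
        omega
      · intro z w h hne
        exact absurd h hne
      · refine eq_bot_iff.2 fun z w h => ?_
        by_contra hne
        have := hK.2 z w h hne
        omega
    rw [hu]
    exact ⟨inferInstance, by simp⟩
  · obtain ⟨e⟩ := exists_noncrossingOn_succ_equiv a m
    have h₁ : ∀ i : Fin (m + 1), Finite (noncrossingOn a (a + i)) ∧
        Nat.card (noncrossingOn a (a + i)) = catalan i := fun i => ih i (by omega) a
    have h₂ : ∀ i : Fin (m + 1), Finite (noncrossingOn (a + i + 1) (a + m + 1)) ∧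
        Nat.card (noncrossingOn (a + i + 1) (a + m + 1)) = catalan (m - i) := fun i => by
      have h := ih (m - i) (by omega) (a + i + 1)
      rwa [show a + i + 1 + (m - i) = a + m + 1 by omega] at h
    have := fun i => (h₁ i).1
    have := fun i => (h₂ i).1
    refine ⟨Finite.of_equiv _ e, ?_⟩
    rw [← add_assoc, ← Nat.card_congr e, Nat.card_sigma, catalan_succ]
    exact Finset.sum_congr rfl fun i _ => by rw [Nat.card_prod, (h₁ i).2, (h₂ i).2]

/-- Noncrossing setoids on `Fin n`, extended trivially to `ℕ`. -/
theorem exists_noncrossing_fin_equiv (n : ℕ) :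
    Nonempty (noncrossingOn 0 n ≃ {K : Setoid (Fin n) // IsNoncrossing K}) := by
  refine ⟨Equiv.ofBijective (fun K => ⟨Setoid.comap Fin.val K.1, fun a b c d hab hbc hcd =>
    K.2.1 a b c d hab hbc hcd⟩) ⟨?_, ?_⟩⟩
  · rintro ⟨K, hK⟩ ⟨K', hK'⟩ h
    have h' : Setoid.comap Fin.val K = Setoid.comap (Fin.val : Fin n → ℕ) K' :=
      congrArg Subtype.val h
    have hiff : ∀ z w : Fin n, K z w ↔ K' z w := fun z w => Setoid.ext_iff.1 h' z w
    refine Subtype.ext (Setoid.ext fun z w => ?_)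
    change K z w ↔ K' z w
    by_cases hne : z = w
    · exact hne ▸ iff_of_true (K.refl _) (K'.refl _)
    by_cases hzw : z < n ∧ w < n
    · exact hiff ⟨z, hzw.1⟩ ⟨w, hzw.2⟩
    · have := hK.2 z w
      have := hK'.2 z w
      grind
  · rintro ⟨K, hK⟩
    have hr : ∀ a, K a a := fun a => K.refl a
    have hs : ∀ a b, K a b → K b a := fun _ _ h => K.symm h
    have ht : ∀ a b c, K a b → K b c → K a c := fun _ _ _ h h' => K.trans h h'
    let L : Setoid ℕ :=
      { r := fun z w => z = w ∨ ∃ (hz : z < n) (hw : w < n), K ⟨z, hz⟩ ⟨w, hw⟩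
        iseqv := ⟨fun _ => Or.inl rfl, by grind, by grind⟩ }
    have hL : ∀ z w, L z w ↔ z = w ∨ ∃ (hz : z < n) (hw : w < n), K ⟨z, hz⟩ ⟨w, hw⟩ :=
      fun _ _ => Iff.rfl
    refine ⟨⟨L, ?_, ?_⟩, Subtype.ext (Setoid.ext fun z w => ?_)⟩
    · intro x y z w hxy hyz hzw hxz hyw
      obtain h | ⟨hx, hz, hxz⟩ := hxz
      · omega
      obtain h | ⟨hy, hw, hyw⟩ := hyw
      · omega
      exact Or.inr ⟨hx, hy, hK ⟨x, hx⟩ ⟨y, hy⟩ ⟨z, hz⟩ ⟨w, hw⟩ hxy hyz hzw hxz hyw⟩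
    · intro z w h hne
      obtain h | ⟨hz, hw, -⟩ := h
      · exact absurd h hne
      · omega
    · change ((z : ℕ) = w ∨ ∃ (hz : (z : ℕ) < n) (hw : (w : ℕ) < n), K ⟨z, hz⟩ ⟨w, hw⟩) ↔ K z w
      constructor
      · rintro (h | ⟨_, _, h⟩)
        · exact Fin.ext h ▸ K.refl _
        · exact h
      · exact fun h => Or.inr ⟨z.2, w.2, h⟩

end Counting

theorem catalan_eq_factorial_div (n : ℕ) :
    catalan n = (2 * n).factorial / (n.factorial * (n + 1).factorial) := by
  rw [catalan_eq_centralBinom_div, Nat.centralBinom, Nat.choose_eq_factorial_div_factorial (by omega),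
    Nat.div_div_eq_div_mul, Nat.factorial_succ, show 2 * n - n = n by omega]
  congr 1
  ring

/-- (Birman–Ko–Lee) In the Birman–Ko–Lee monoid `BKLₙ⁺`, the set of left divisors of
`δₙ = σ_{n-1,n} σ_{n-2,n-1} ⋯ σ_{2,3} σ_{1,2}` is finite, of cardinality the `n`-th
Catalan number `(2n)! / (n! (n+1)!)`. -/
theorem bkl_divisors_card_catalan (n : ℕ) :
    {p : BKLMonoid n | ∃ q : BKLMonoid n, p * q = bklDelta n}.Finite ∧
    Nat.card {p : BKLMonoid n | ∃ q : BKLMonoid n, p * q = bklDelta n} =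
      (2 * n).factorial / (n.factorial * (n + 1).factorial) := by
  obtain ⟨e⟩ := exists_noncrossing_equiv_divisors n
  obtain ⟨e'⟩ := exists_noncrossing_fin_equiv n
  obtain ⟨hf, hc⟩ := card_noncrossingOn n 0
  rw [Nat.zero_add] at hf hc
  refine ⟨Finite.of_equiv _ (e'.trans e), ?_⟩
  rw [← Nat.card_congr (e'.trans e), hc, catalan_eq_factorial_div]
end

section
/- (Paris) Every Artin monoid injects in its Artin group: for any Coxeter graph Γ over a finite set S, the canonical monoid homomorphism A⁺(Γ) → A(Γ) sending each generator σ_s to σ_s is injective; moreover, two positive words in the generators {σ_s : s ∈ S} represent the same element of A(Γ) if and only if they represent the same element of A⁺(Γ). -/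
/-- The alternating product `prod(x, y; m) = x y x y ⋯` with `m` factors. -/
def altProd {G : Type*} [Monoid G] : G → G → ℕ → G
  | _, _, 0 => 1
  | x, y, m + 1 => x * altProd y x m

/-- Relators of the Artin group `A(Γ)` of a Coxeter graph over `S` with labelling `M`
(where `M s t = 0` encodes the label `∞`, and otherwise `M s t ≥ 2`): for each pair
`s ≠ t` with finite label, the relator `prod(σ_s, σ_t; M s t) · prod(σ_t, σ_s; M s t)⁻¹`. -/
def artinRels (S : Type*) (M : S → S → ℕ) : Set (FreeGroup S) :=
  {w | ∃ s t : S, s ≠ t ∧ M s t ≠ 0 ∧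
        w = altProd (FreeGroup.of s) (FreeGroup.of t) (M s t) *
            (altProd (FreeGroup.of t) (FreeGroup.of s) (M s t))⁻¹}

/-- The Artin group `A(Γ)` associated to the Coxeter graph `Γ` over `S` with labels `M`. -/
abbrev ArtinGroup (S : Type*) (M : S → S → ℕ) : Type _ := PresentedGroup (artinRels S M)

/-- The defining relations of the Artin monoid `A⁺(Γ)`:
`prod(σ_s, σ_t; M s t) = prod(σ_t, σ_s; M s t)` for each pair `s ≠ t` with finite label. -/
inductive ArtinMonoidRel (S : Type*) (M : S → S → ℕ) :
    FreeMonoid S → FreeMonoid S → Prop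
  | rel (s t : S) (hst : s ≠ t) (hfin : M s t ≠ 0) :
      ArtinMonoidRel S M (altProd (FreeMonoid.of s) (FreeMonoid.of t) (M s t))
        (altProd (FreeMonoid.of t) (FreeMonoid.of s) (M s t))

/-- The Artin monoid `A⁺(Γ)`: the quotient of the free monoid on `{σ_s : s ∈ S}` by the
monoid congruence generated by the Artin relations. -/
abbrev ArtinMonoid (S : Type*) (M : S → S → ℕ) : Type _ :=
  (conGen (ArtinMonoidRel S M)).Quotient

section Products

variable {G H : Type*} [Monoid G] [Monoid H]

/-- The ordered product `f 0 * f 1 * ⋯ * f (n - 1)`. -/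
def rprod (f : ℕ → G) : ℕ → G
  | 0 => 1
  | n + 1 => rprod f n * f n

@[simp] lemma rprod_zero (f : ℕ → G) : rprod f 0 = 1 := rfl

lemma rprod_succ (f : ℕ → G) (n : ℕ) : rprod f (n + 1) = rprod f n * f n := rfl

lemma map_rprod (φ : G →* H) (f : ℕ → G) (n : ℕ) :
    φ (rprod f n) = rprod (fun k => φ (f k)) n := by
  induction n with
  | zero => simp
  | succ n ih => simp [rprod_succ, ih]

lemma rprod_congr {f g : ℕ → G} {n : ℕ} (h : ∀ k < n, f k = g k) : rprod f n = rprod g n := by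
  induction n with
  | zero => rfl
  | succ n ih => rw [rprod_succ, rprod_succ, ih fun k hk => h k (by omega), h n (by omega)]

lemma rprod_eq_one {f : ℕ → G} {n : ℕ} (h : ∀ k < n, f k = 1) : rprod f n = 1 := by
  induction n with
  | zero => rfl
  | succ n ih => rw [rprod_succ, ih fun k hk => h k (by omega), h n (by omega), one_mul]

lemma rprod_add (f : ℕ → G) (a b : ℕ) :
    rprod f (a + b) = rprod f a * rprod (fun k => f (a + k)) b := by
  induction b with
  | zero => simp
  | succ b ih => rw [← add_assoc, rprod_succ, ih, rprod_succ, mul_assoc]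

lemma rprod_succ' (f : ℕ → G) (n : ℕ) :
    rprod f (n + 1) = f 0 * rprod (fun k => f (k + 1)) n := by
  rw [add_comm, rprod_add]
  simp [rprod_succ, add_comm]

lemma rprod_commute {f : ℕ → G} {x : G} {n : ℕ} (h : ∀ k < n, Commute (f k) x) :
    Commute (rprod f n) x := by
  induction n with
  | zero => exact Commute.one_left x
  | succ n ih => exact (ih fun k hk => h k (by omega)).mul_left (h n (by omega))

lemma rprod_mul {y z : ℕ → G} {n : ℕ}
    (h : ∀ i j, i < j → j < n → Commute (z i) (y j)) :
    rprod (fun k => y k * z k) n = rprod y n * rprod z n := by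
  induction n with
  | zero => simp
  | succ n ih =>
    have hc : Commute (rprod z n) (y n) := rprod_commute fun k hk => h k n hk (by omega)
    rw [rprod_succ, ih fun i j hij hj => h i j hij (by omega), rprod_succ, rprod_succ]
    simp only [mul_assoc]
    rw [← mul_assoc (rprod z n), hc.eq, mul_assoc]

lemma rprod_comm {x : ℕ → ℕ → G} {n m : ℕ}
    (h : ∀ i j d e, i < j → j < n → d < e → e < m → Commute (x i e) (x j d)) :
    rprod (fun j => rprod (x j) m) n = rprod (fun d => rprod (fun j => x j d) n) m := by
  induction m with
  | zero => exact rprod_eq_one fun _ _ => rfl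
  | succ m ih =>
    rw [rprod_succ, ← ih fun i j d e hij hj hd he => h i j d e hij hj hd (by omega)]
    refine rprod_mul fun i j hij hj => ?_
    exact (rprod_commute fun d hd => (h i j d m hij hj hd (by omega)).symm).symm

lemma rprod_semiconj {f g : ℕ → G} {δ : G} {n : ℕ} (h : ∀ k < n, δ * f k = g k * δ) :
    δ * rprod f n = rprod g n * δ := by
  induction n with
  | zero => simp
  | succ n ih =>
    rw [rprod_succ, ← mul_assoc, ih fun k hk => h k (by omega), mul_assoc, h n (by omega),
      rprod_succ, mul_assoc]

lemma exists_rprod_eq_mul {f : ℕ → G} {n : ℕ} (h : ∀ i j, Commute (f i) (f j)) {k : ℕ}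
    (hk : k < n) : ∃ g, rprod f n = f k * g ∧ rprod f n = g * f k := by
  induction n with
  | zero => omega
  | succ n ih =>
    rcases Nat.lt_succ_iff_lt_or_eq.mp hk with hk | rfl
    · obtain ⟨g, h₁, h₂⟩ := ih hk
      refine ⟨g * f n, ?_, ?_⟩
      · rw [rprod_succ, h₁, mul_assoc]
      · rw [rprod_succ, h₂, mul_assoc, mul_assoc, (h k n).eq]
    · refine ⟨rprod f k, ?_, rprod_succ f k⟩
      rw [rprod_succ, (rprod_commute fun i _ => h i k).eq]

lemma altProd_zero (x y : G) : altProd x y 0 = 1 := rfl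

lemma altProd_succ (x y : G) (m : ℕ) : altProd x y (m + 1) = x * altProd y x m := rfl

lemma map_altProd (φ : G →* H) (x y : G) (m : ℕ) :
    φ (altProd x y m) = altProd (φ x) (φ y) m := by
  induction m generalizing x y with
  | zero => simp [altProd_zero]
  | succ m ih => simp [altProd_succ, ih]

lemma altProd_eq_rprod (x y : G) (m : ℕ) :
    altProd x y m = rprod (fun j => if Even j then x else y) m := by
  induction m generalizing x y with
  | zero => rfl
  | succ m ih =>
    rw [altProd_succ, ih, rprod_succ']
    simp only [Nat.even_add_one, ite_not, Even.zero, if_true]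

end Products

section Bricks

variable {G : Type*} [Monoid G]

/-- The descending product `σ (n - 1) * ⋯ * σ 0`. -/
def descProd (σ : ℕ → G) : ℕ → G
  | 0 => 1
  | n + 1 => σ n * descProd σ n

lemma rprod_desc (σ : ℕ → G) (d : ℕ) :
    rprod (fun j => σ (d - j)) (d + 1) = descProd σ (d + 1) := by
  induction d with
  | zero => simp [rprod_succ, descProd]
  | succ d ih =>
    rw [rprod_succ', descProd, ← ih]
    simp

lemma descProd_commute {σ : ℕ → G} {x : G} {n : ℕ} (h : ∀ k < n, Commute (σ k) x) :
    Commute (descProd σ n) x := by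
  induction n with
  | zero => exact Commute.one_left x
  | succ n ih => exact (h n (by omega)).mul_left (ih fun k hk => h k (by omega))

lemma descProd_mul {σ : ℕ → G} {n : ℕ}
    (hc : ∀ k l, k + 1 < l → l < n → Commute (σ k) (σ l))
    (hb : ∀ k, k + 1 < n → σ k * σ (k + 1) * σ k = σ (k + 1) * σ k * σ (k + 1)) {k : ℕ}
    (hk : k + 1 < n) : descProd σ n * σ (k + 1) = σ k * descProd σ n := by
  induction n with
  | zero => omega
  | succ n ih =>
    rcases Nat.lt_succ_iff_lt_or_eq.mp hk with hk' | rfl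
    · rw [descProd, mul_assoc, ih (fun k l h h' => hc k l h (by omega))
        (fun k h => hb k (by omega)) hk', ← mul_assoc, ← mul_assoc, (hc k n hk' (by omega)).eq]
    · have h₁ : Commute (descProd σ k) (σ (k + 1)) :=
        descProd_commute fun l hl => hc l (k + 1) (by omega) (by omega)
      simp only [descProd]
      rw [mul_assoc, mul_assoc, h₁.eq, ← mul_assoc (σ k), ← mul_assoc (σ (k + 1)),
        ← mul_assoc (σ (k + 1)), ← hb k (by omega)]
      simp only [mul_assoc]

/-- The `d`-th antidiagonal of the brick of width `n`. -/
def brickDiag (σ : ℕ → G) (n d : ℕ) : G :=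
  rprod (fun j => if j ≤ d ∧ d - j < n then σ (d - j) else 1) (n + 1)

lemma brickDiag_of_lt (σ : ℕ → G) {n d : ℕ} (h : d < n) :
    brickDiag σ n d = descProd σ (d + 1) := by
  obtain ⟨c, rfl⟩ := Nat.exists_eq_add_of_lt h
  rw [brickDiag, show d + c + 1 + 1 = (d + 1) + (c + 1) by omega, rprod_add,
    rprod_eq_one (n := c + 1), mul_one, ← rprod_desc]
  · refine rprod_congr fun k hk => if_pos (by omega)
  · exact fun k hk => if_neg (by omega)

lemma brickDiag_self (σ : ℕ → G) (n : ℕ) : brickDiag σ (n + 1) (n + 1) = descProd σ (n + 1) := by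
  rw [brickDiag, rprod_succ', if_neg (by omega), one_mul, ← rprod_desc]
  refine rprod_congr fun k hk => ?_
  rw [if_pos (by omega)]
  congr 1
  omega

lemma descProd_mul_brickDiag {σ : ℕ → G} {n : ℕ}
    (hc : ∀ k l, k + 1 < l → l < n + 1 → Commute (σ k) (σ l))
    (hb : ∀ k, k + 1 < n + 1 → σ k * σ (k + 1) * σ k = σ (k + 1) * σ k * σ (k + 1)) {d : ℕ}
    (hd : n ≤ d) :
    descProd σ (n + 1) * brickDiag σ (n + 1) (d + 2) = brickDiag σ n d * descProd σ (n + 1) := by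
  rw [brickDiag, rprod_succ', if_neg (by omega), one_mul, brickDiag]
  refine rprod_semiconj fun k hk => ?_
  by_cases h : d - k < n ∧ k ≤ d
  · rw [if_pos (by omega), if_pos (by omega), show d + 2 - (k + 1) = d - k + 1 by omega]
    exact descProd_mul hc hb (by omega)
  · rw [if_neg (by omega), if_neg (by omega), one_mul, mul_one]

lemma rprod_brickDiag {σ : ℕ → G} {n : ℕ}
    (hc : ∀ k l, k + 1 < l → l < n → Commute (σ k) (σ l))
    (hb : ∀ k, k + 1 < n → σ k * σ (k + 1) * σ k = σ (k + 1) * σ k * σ (k + 1)) (o : ℕ) :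
    rprod (fun d => if Even (d + o) then brickDiag σ n d else 1) (2 * n + 1) =
      rprod (fun d => descProd σ (d + 1)) n := by
  induction n with
  | zero => simp [rprod_succ, brickDiag]
  | succ n ih =>
    rw [rprod_succ (fun d => descProd σ (d + 1)), ← ih (fun k l h h' => hc k l h (by omega))
        (fun k h => hb k (by omega)),
      show 2 * (n + 1) + 1 = n + (2 + (n + 1)) by ring, rprod_add _ n (2 + (n + 1)), rprod_add _ 2,
      show 2 * n + 1 = n + (n + 1) by ring, rprod_add _ n (n + 1), mul_assoc]
    have h₁ : rprod (fun d => if Even (n + d + o) then brickDiag σ (n + 1) (n + d) else 1) 2 =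
        descProd σ (n + 1) := by
      simp only [rprod_succ, rprod_zero, one_mul, add_zero]
      rw [brickDiag_of_lt σ (Nat.lt_succ_self n), brickDiag_self]
      by_cases h : Even (n + o)
      · rw [if_pos h, if_neg (by rw [Nat.even_iff] at h ⊢; omega), mul_one]
      · rw [if_neg h, if_pos (by rw [Nat.even_iff] at h ⊢; omega), one_mul]
    rw [h₁]
    congr 1
    · refine rprod_congr fun k hk => ?_
      rw [brickDiag_of_lt σ hk, brickDiag_of_lt σ (by omega)]
    · refine rprod_semiconj fun k hk => ?_
      have hp : Even (n + (2 + k) + o) ↔ Even (n + k + o) := by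
        simp only [Nat.even_iff]; omega
      by_cases h : Even (n + k + o)
      · rw [if_pos h, if_pos (hp.mpr h), show n + (2 + k) = n + k + 2 by ring]
        exact descProd_mul_brickDiag hc hb (by omega)
      · rw [if_neg h, if_neg (by rwa [hp]), one_mul, mul_one]

/-- The brick of width `N` with `m` rows, whose entry in row `j` and column `k` is `A k` or `1`
according to the parity of `j + o + k`. -/
def brick (A : ℕ → G) (m N o : ℕ) : G :=
  rprod (fun j => rprod (fun k => if Even (j + o + k) then A k else 1) N) m

lemma brick_eq_single {σ : ℕ → G} {n : ℕ}
    (hc : ∀ k l, k + 1 < l → l < n → Commute (σ k) (σ l))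
    (hb : ∀ k, k + 1 < n → σ k * σ (k + 1) * σ k = σ (k + 1) * σ k * σ (k + 1)) (o : ℕ) :
    brick σ (n + 1) n o = rprod (fun d => descProd σ (d + 1)) n := by
  rw [← rprod_brickDiag hc hb o]
  trans rprod (fun j => rprod
    (fun d => if Even (d + o) ∧ j ≤ d ∧ d - j < n then σ (d - j) else 1) (2 * n + 1)) (n + 1)
  · refine rprod_congr fun j hj => ?_
    rw [show 2 * n + 1 = j + (n + (n + 1 - j)) by omega, rprod_add, rprod_add,
      rprod_eq_one (n := j), rprod_eq_one (n := n + 1 - j), one_mul, mul_one]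
    · refine rprod_congr fun k hk => ?_
      have hp : Even (j + o + k) ↔ Even (j + k + o) := by rw [add_right_comm]
      by_cases h : Even (j + k + o)
      · rw [if_pos (hp.mpr h), if_pos ⟨h, by omega, by omega⟩, Nat.add_sub_cancel_left]
      · rw [if_neg (by rwa [hp]), if_neg fun h' => h h'.1]
    · exact fun k hk => if_neg (by omega)
    · exact fun k hk => if_neg (by omega)
  · rw [rprod_comm]
    · refine rprod_congr fun d _ => ?_
      by_cases h : Even (d + o)
      · simp only [h, true_and, if_true]; rfl
      · simp only [h, false_and, if_false]
        exact rprod_eq_one fun _ _ => rfl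
    · intro i j d e hij hj hd he
      split_ifs with h₁ h₂
      · exact (hc _ _ (by omega) (by omega)).symm
      · exact Commute.one_right _
      · exact Commute.one_left _
      · exact Commute.one_left _

lemma brick_eq {A : ℕ → G} {n : ℕ}
    (hc : ∀ k l, k < l → (k / n ≠ l / n ∨ k + 1 < l) → Commute (A k) (A l))
    (hb : ∀ k, k / n = (k + 1) / n →
      A k * A (k + 1) * A k = A (k + 1) * A k * A (k + 1)) (B o o' : ℕ) :
    brick A (n + 1) (n * B) o = brick A (n + 1) (n * B) o' := by
  rcases Nat.eq_zero_or_pos n with rfl | hn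
  · simp [brick, rprod_succ]
  have hdiv : ∀ c k, k < n → (n * c + k) / n = c := fun c k hk => by
    rw [Nat.mul_add_div hn, Nat.div_eq_of_lt hk, add_zero]
  have key : ∀ o, brick A (n + 1) (n * B) o =
      rprod (fun c => rprod (fun d => descProd (fun k => A (n * c + k)) (d + 1)) n) B := by
    intro o
    induction B with
    | zero => exact rprod_eq_one fun _ _ => rfl
    | succ B ih =>
      rw [rprod_succ, ← ih, ← brick_eq_single (σ := fun k => A (n * B + k)) (n := n)
        (o := o + n * B)]
      · rw [brick, brick, brick, ← rprod_mul]
        · refine rprod_congr fun j _ => ?_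
          rw [mul_add, mul_one, rprod_add]
          simp only [add_assoc]
        · intro i j _ _
          refine rprod_commute fun k hk => (rprod_commute fun l hl => ?_).symm
          have h₁ : l / n < B := Nat.div_lt_of_lt_mul hl
          have h₂ := hdiv B k hk
          split_ifs
          · exact hc _ _ (by omega) (Or.inl (by omega))
          · exact Commute.one_right _
          · exact Commute.one_left _
          · exact Commute.one_left _
      · exact fun k l h _ => hc _ _ (by omega) (Or.inr (by omega))
      · exact fun k h => hb (n * B + k) (by rw [hdiv B k (by omega), add_assoc, hdiv B _ h])
  rw [key, key]

lemma altProd_eq_brick_mul {a b : ℕ → G} (haa : ∀ k l, Commute (a k) (a l))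
    (hbb : ∀ k l, Commute (b k) (b l))
    (hab : ∀ k l, (Even k ↔ Even l) → Commute (a k) (b l)) (m N : ℕ) :
    altProd (rprod a N) (rprod b N) m =
      brick (fun k => if Even k then a k else b k) m N 0 *
        brick (fun k => if Even k then b k else a k) m N 1 := by
  have hAB : ∀ k l, Commute (if Even k then b k else a k) (if Even l then a l else b l) := by
    intro k l
    split_ifs with h₁ h₂ h₂
    · exact (hab l k (by tauto)).symm
    · exact hbb _ _
    · exact haa _ _
    · exact hab _ _ (by tauto)
  rw [altProd_eq_rprod, brick, brick, ← rprod_mul]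
  · refine rprod_congr fun j _ => ?_
    rw [← rprod_mul]
    · split_ifs with hj
      · refine rprod_congr fun k _ => ?_
        by_cases hk : Even k <;> simp [hj, hk, Nat.even_add, parity_simps]
      · refine rprod_congr fun k _ => ?_
        by_cases hk : Even k <;> simp [hj, hk, Nat.even_add, parity_simps]
    · intro i k _ _
      split_ifs <;> first | exact Commute.one_right _ | exact Commute.one_left _ | skip
      all_goals first | exact haa _ _ | exact hbb _ _ | exact hab _ _ (by tauto)
                      | exact (hab _ _ (by tauto)).symm
  · intro i j _ _
    refine rprod_commute fun k _ => (rprod_commute fun l _ => ?_).symm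
    have := hAB k l
    split_ifs at this ⊢ <;> first | exact Commute.one_right _ | exact Commute.one_left _ | skip
    all_goals exact this.symm

/-- Two commuting families whose mutual relations are those of a disjoint union of paths
of length `n` (type `A_n`) satisfy, after multiplication, the dihedral relation of length
`n + 1`. -/
lemma altProd_rprod {a b : ℕ → G} {n : ℕ} (haa : ∀ k l, Commute (a k) (a l))
    (hbb : ∀ k l, Commute (b k) (b l))
    (hab : ∀ k l, ¬ (k / n = l / n ∧ (k = l + 1 ∨ l = k + 1)) → Commute (a k) (b l))
    (hbr : ∀ k l, k / n = l / n → (k = l + 1 ∨ l = k + 1) → a k * b l * a k = b l * a k * b l)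
    (B : ℕ) :
    altProd (rprod a (n * B)) (rprod b (n * B)) (n + 1) =
      altProd (rprod b (n * B)) (rprod a (n * B)) (n + 1) := by
  have hpar : ∀ k l, (Even k ↔ Even l) → Commute (a k) (b l) := fun k l h => hab k l (by
    rintro ⟨-, rfl | rfl⟩ <;> simp only [Nat.even_add_one] at h <;> tauto)
  have hcomm : ∀ k l, k < l → (k / n ≠ l / n ∨ k + 1 < l) → Commute (a k) (b l) :=
    fun k l h h' => hab k l (by omega)
  have hcomm' : ∀ k l, k < l → (k / n ≠ l / n ∨ k + 1 < l) → Commute (b k) (a l) :=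
    fun k l h h' => (hab l k (by omega)).symm
  rw [altProd_eq_brick_mul haa hbb hpar, altProd_eq_brick_mul hbb haa
    fun k l h => (hpar l k h.symm).symm]
  have e₁ : brick (fun k => if Even k then a k else b k) (n + 1) (n * B) 0 =
      brick (fun k => if Even k then a k else b k) (n + 1) (n * B) 1 := by
    apply brick_eq
    · intro k l h h'
      split_ifs
      exacts [haa _ _, hcomm _ _ h h', hcomm' _ _ h h', hbb _ _]
    · intro k h
      by_cases hk : Even k
      · simp [hk, parity_simps, hbr k (k + 1) h (Or.inr rfl)]
      · simp [hk, parity_simps, (hbr (k + 1) k h.symm (Or.inl rfl)).symm]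
  have e₂ : brick (fun k => if Even k then b k else a k) (n + 1) (n * B) 0 =
      brick (fun k => if Even k then b k else a k) (n + 1) (n * B) 1 := by
    apply brick_eq
    · intro k l h h'
      split_ifs
      exacts [hbb _ _, hcomm' _ _ h h', hcomm _ _ h h', haa _ _]
    · intro k h
      by_cases hk : Even k
      · simp [hk, parity_simps, (hbr (k + 1) k h.symm (Or.inl rfl)).symm]
      · simp [hk, parity_simps, hbr k (k + 1) h (Or.inr rfl)]
  rw [e₁, ← e₂]
  have hc : Commute (brick (fun k => if Even k then a k else b k) (n + 1) (n * B) 1)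
      (brick (fun k => if Even k then b k else a k) (n + 1) (n * B) 0) := by
    refine rprod_commute fun i _ => (rprod_commute fun j _ => ?_).symm
    refine rprod_commute fun k _ => (rprod_commute fun l _ => ?_).symm
    beta_reduce
    split_ifs <;> first | exact Commute.one_right _ | exact Commute.one_left _ | skip
    all_goals first | exact haa _ _ | exact hbb _ _ | exact hpar _ _ (by tauto)
                    | exact (hpar _ _ (by tauto)).symm
  exact hc.eq

end Bricks

section Alternating

variable {α : Type*}

/-- The `k`-th letter of the alternating word `x y x y ⋯`. -/
def altLetter : α → α → ℕ → α
  | x, _, 0 => x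
  | x, y, k + 1 => altLetter y x k

lemma altLetter_succ (x y : α) (k : ℕ) : altLetter x y (k + 1) = altLetter y x k := rfl

lemma altLetter_cases (x y : α) (k : ℕ) :
    (altLetter x y k = x ∧ altLetter y x k = y) ∨ (altLetter x y k = y ∧ altLetter y x k = x) := by
  induction k generalizing x y with
  | zero => exact Or.inl ⟨rfl, rfl⟩
  | succ k ih => rw [altLetter_succ, altLetter_succ]; exact (ih x y).symm.imp And.symm And.symm

lemma altProd_succ_right {G : Type*} [Monoid G] (x y : G) (k : ℕ) :
    altProd x y (k + 1) = altProd x y k * altLetter x y k := by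
  induction k generalizing x y with
  | zero => simp [altProd_succ, altProd_zero, altLetter]
  | succ k ih => rw [altProd_succ, ih, altProd_succ x y k, altLetter_succ, mul_assoc]

lemma exists_altProd_add {G : Type*} [Monoid G] (x y : G) (m k : ℕ) :
    ∃ c, altProd x y (m + k) = altProd x y m * c := by
  induction k with
  | zero => exact ⟨1, by simp⟩
  | succ k ih =>
    obtain ⟨c, hc⟩ := ih
    exact ⟨_, by rw [← add_assoc, altProd_succ_right, hc, mul_assoc]⟩

end Alternating

namespace ArtinMonoid

variable {S : Type*} {M : S → S → ℕ}

variable (M) in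
/-- The generators of the Artin monoid. -/
def gen (s : S) : ArtinMonoid S M := (conGen (ArtinMonoidRel S M)).mk' (FreeMonoid.of s)

lemma braid {s t : S} (hst : s ≠ t) (h : M s t ≠ 0) :
    altProd (gen M s) (gen M t) (M s t) = altProd (gen M t) (gen M s) (M s t) := by
  simp only [gen, ← map_altProd]
  exact (Con.eq _).mpr (ConGen.Rel.of _ _ (.rel s t hst h))

/-- The morphism out of the Artin monoid induced by elements satisfying the Artin relations. -/
def lift {N : Type*} [Monoid N] (g : S → N)
    (hg : ∀ s t, s ≠ t → M s t ≠ 0 → altProd (g s) (g t) (M s t) = altProd (g t) (g s) (M s t)) :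
    ArtinMonoid S M →* N :=
  (conGen (ArtinMonoidRel S M)).lift (FreeMonoid.lift g) (Con.conGen_le.mpr (by
    rintro _ _ ⟨s, t, hst, h⟩
    simpa [Con.ker_rel, map_altProd] using hg s t hst h))

@[simp] lemma lift_gen {N : Type*} [Monoid N] (g : S → N)
    (hg : ∀ s t, s ≠ t → M s t ≠ 0 → altProd (g s) (g t) (M s t) = altProd (g t) (g s) (M s t))
    (s : S) : lift g hg (gen M s) = g s := by
  simp [lift, gen]

variable (M) in
/-- The element of the Artin monoid represented by a word. -/
def ofWord (l : List S) : ArtinMonoid S M := (l.map (gen M)).prod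

@[simp] lemma ofWord_nil : ofWord M [] = 1 := rfl

@[simp] lemma ofWord_cons (s : S) (l : List S) : ofWord M (s :: l) = gen M s * ofWord M l := rfl

@[simp] lemma ofWord_append (l l' : List S) : ofWord M (l ++ l') = ofWord M l * ofWord M l' := by
  simp [ofWord]

lemma exists_ofWord (a : ArtinMonoid S M) : ∃ l, ofWord M l = a := by
  obtain ⟨w, rfl⟩ := Con.mk'_surjective a
  induction w using FreeMonoid.inductionOn' with
  | one => exact ⟨[], by simp⟩
  | of_mul s w ih =>
    obtain ⟨l, hl⟩ := ih
    exact ⟨s :: l, by rw [ofWord_cons, hl, map_mul]; rfl⟩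

/-- The length morphism. -/
def lengthHom : ArtinMonoid S M →* Multiplicative ℕ :=
  lift (fun _ => Multiplicative.ofAdd 1) fun _ _ _ _ => rfl

/-- The length of an element of the Artin monoid. -/
def length (a : ArtinMonoid S M) : ℕ := (lengthHom a).toAdd

lemma length_mul (a b : ArtinMonoid S M) : length (a * b) = length a + length b := by
  simp [length]

lemma length_gen_mul (s : S) (b : ArtinMonoid S M) : length (gen M s * b) = length b + 1 := by
  rw [length_mul, add_comm]
  simp [length, lengthHom]

lemma eq_one_or_gen_mul (a : ArtinMonoid S M) : a = 1 ∨ ∃ s b, a = gen M s * b := by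
  obtain ⟨l, rfl⟩ := exists_ofWord a
  cases l with
  | nil => exact Or.inl rfl
  | cons s l => exact Or.inr ⟨s, _, rfl⟩

lemma exists_altProd_prefix {s t : S} {l : List S} (hl : ∀ x ∈ l, x = s ∨ x = t)
    (hs : l.head? ≠ some s) (hst : s ≠ t) :
    ∃ k l', ofWord M l = altProd (gen M t) (gen M s) k * ofWord M l' ∧
      l.length = k + l'.length ∧ (∀ x ∈ l', x = s ∨ x = t) ∧
      l'.head? ≠ some (altLetter t s k) ∧ (l = [] ∨ 1 ≤ k) := by
  induction l generalizing s t with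
  | nil => exact ⟨0, [], by simp [altProd_zero]⟩
  | cons x l ih =>
    have hx : x = t := (hl x (by simp)).resolve_left fun h => hs (by simp [h])
    subst hx
    have hl' : ∀ y ∈ l, y = s ∨ y = x := fun y hy => hl y (by simp [hy])
    by_cases h : l.head? = some x
    · refine ⟨1, l, by simp [altProd_succ, altProd_zero], by simp [add_comm], hl', ?_, by simp⟩
      rw [h]
      simpa [altLetter] using hst.symm
    · obtain ⟨k, l', h₁, h₂, h₃, h₄, -⟩ := ih (fun y hy => (hl' y hy).symm) h hst.symm
      refine ⟨k + 1, l', ?_, ?_, fun y hy => (h₃ y hy).symm, h₄, by simp⟩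
      · rw [ofWord_cons, h₁, altProd_succ, mul_assoc]
      · simp [h₂]; ring

section Positivity

variable {I : Type*} {P : ArtinMonoid S M → I → I → Prop} {τ : I → S}

lemma exists_of_no_delta (hsymm : ∀ s t, s ≠ t → M s t = M t s)
    (P_one : ∀ i, P 1 i i) (P_mul : ∀ a b i j k, P a i k → P b k j → P (a * b) i j)
    (hP : ∀ s t, s ≠ t → ∀ k, 1 ≤ k → (M s t = 0 ∨ k < M s t) → ∀ i, τ i = s →
      ∃ j, τ j = altLetter t s k ∧ P (altProd (gen M t) (gen M s) k) i j)
    (n : ℕ) (s t : S) (hst : s ≠ t) (l : List S) (hn : l.length ≤ n)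
    (hl : ∀ x ∈ l, x = s ∨ x = t) (hs : l.head? ≠ some s)
    (hΔ : M s t ≠ 0 → ∀ u b, (∀ x ∈ u, x = s ∨ x = t) →
      ofWord M l ≠ ofWord M u * altProd (gen M s) (gen M t) (M s t) * b)
    (i : I) (hi : τ i = s) : ∃ j, (τ j = s ∨ τ j = t) ∧ P (ofWord M l) i j := by
  induction n generalizing s t l i with
  | zero =>
    obtain rfl := List.length_eq_zero_iff.mp (Nat.le_zero.mp hn)
    exact ⟨i, Or.inl hi, P_one i⟩
  | succ n ih =>
    obtain ⟨k, l', h₁, h₂, h₃, h₄, h₅⟩ := exists_altProd_prefix (M := M) hl hs hst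
    rcases h₅ with rfl | hk
    · exact ⟨i, Or.inl hi, P_one i⟩
    have hkm : M s t = 0 ∨ k < M s t := by
      by_contra! h
      obtain ⟨c, hc⟩ := exists_altProd_add (gen M t) (gen M s) (M s t) (k - M s t)
      refine hΔ h.1 [] (c * ofWord M l') (by simp) ?_
      rw [h₁, ← Nat.add_sub_of_le h.2, hc, ← braid hst h.1]
      simp [mul_assoc]
    obtain ⟨j, hj, hPj⟩ := hP s t hst k hk hkm i hi
    have hΔ' : M s t ≠ 0 → ∀ u b, (∀ x ∈ u, x = s ∨ x = t) →
        ofWord M l' ≠ ofWord M u * altProd (gen M s) (gen M t) (M s t) * b := by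
      intro hm u b hu h
      obtain ⟨v, hv, hv'⟩ : ∃ v, (∀ x ∈ v, x = s ∨ x = t) ∧
          ofWord M v = altProd (gen M t) (gen M s) k := by
        clear * -
        induction k generalizing s t with
        | zero => exact ⟨[], by simp [altProd_zero]⟩
        | succ k ih =>
          obtain ⟨v, hv, hv'⟩ := ih t s
          exact ⟨t :: v, by simpa using fun x hx => (hv x hx).symm, by simp [hv', altProd_succ]⟩
      refine hΔ hm (v ++ u) b ?_ ?_
      · simp only [List.mem_append]
        rintro x (hx | hx)
        exacts [hv x hx, hu x hx]
      · rw [h₁, h, ofWord_append, hv']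
        simp only [mul_assoc]
    have hlen : l'.length ≤ n := by omega
    rcases altLetter_cases t s k with ⟨e, -⟩ | ⟨e, -⟩
    · rw [e] at hj h₄
      obtain ⟨j', hj', hPj'⟩ := ih t s hst.symm l' hlen (fun x hx => (h₃ x hx).symm) h₄ (by
        intro hm u b hu
        rw [braid hst.symm hm, hsymm t s hst.symm]
        exact hΔ' (by rwa [hsymm s t hst]) u b fun x hx => (hu x hx).symm) j hj
      exact ⟨j', hj'.symm, h₁ ▸ P_mul _ _ _ _ _ hPj hPj'⟩
    · rw [e] at hj h₄
      obtain ⟨j', hj', hPj'⟩ := ih s t hst l' hlen h₃ h₄ hΔ' j hj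
      exact ⟨j', hj', h₁ ▸ P_mul _ _ _ _ _ hPj hPj'⟩

lemma exists_ofWord_mul_delta {s t : S} (hst : s ≠ t) (hm : M s t ≠ 0) {u : List S}
    (hu : ∀ x ∈ u, x = s ∨ x = t) :
    ∃ c, ofWord M u * altProd (gen M s) (gen M t) (M s t) =
      altProd (gen M s) (gen M t) (M s t) * c := by
  induction u with
  | nil => exact ⟨1, by simp⟩
  | cons x u ih =>
    obtain ⟨c, hc⟩ := ih fun y hy => hu y (by simp [hy])
    have hx : ∃ d, gen M x * altProd (gen M s) (gen M t) (M s t) =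
        altProd (gen M s) (gen M t) (M s t) * d := by
      rcases hu x (by simp) with rfl | rfl
      · refine ⟨altLetter (gen M x) (gen M t) (M x t), ?_⟩
        rw [← altProd_succ_right, altProd_succ, braid hst hm]
      · refine ⟨altLetter (gen M x) (gen M s) (M s x), ?_⟩
        rw [braid hst hm, ← altProd_succ_right, altProd_succ, braid hst hm]
    obtain ⟨d, hd⟩ := hx
    exact ⟨d * c, by rw [ofWord_cons, mul_assoc, hc, ← mul_assoc, hd, mul_assoc]⟩

/-- If a family of nonnegative-type relations has enough nonzero entries on alternating words,
then a row indexed by a generator not dividing `b` on the left has a nonzero entry. -/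
theorem exists_of_not_dvd (hsymm : ∀ s t, s ≠ t → M s t = M t s)
    (P_one : ∀ i, P 1 i i) (P_mul : ∀ a b i j k, P a i k → P b k j → P (a * b) i j)
    (hP : ∀ s t, s ≠ t → ∀ k, 1 ≤ k → (M s t = 0 ∨ k < M s t) → ∀ i, τ i = s →
      ∃ j, τ j = altLetter t s k ∧ P (altProd (gen M t) (gen M s) k) i j)
    (b : ArtinMonoid S M) (i : I) (hb : ¬ gen M (τ i) ∣ b) : ∃ j, P b i j := by
  classical
  induction hn : length b using Nat.strong_induction_on generalizing b i with
  | _ n ih =>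
  subst hn
  rcases eq_one_or_gen_mul b with rfl | ⟨t, b', hbt⟩
  · exact ⟨i, P_one i⟩
  generalize hs : τ i = s at hb
  have hst : s ≠ t := by
    rintro rfl
    exact hb ⟨b', hbt⟩
  have hex : ∃ n, ∃ l c, (∀ x ∈ l, x = s ∨ x = t) ∧ b = ofWord M l * c ∧ length c = n :=
    ⟨_, [t], b', by simp, by simpa using hbt, rfl⟩
  obtain ⟨l, c, hl, hlc, hc⟩ := Nat.find_spec hex
  have hmin := fun n => Nat.find_min' hex (m := n)
  rw [← hc] at hmin
  have hcb : length c < length b := by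
    rw [hbt, length_gen_mul]
    exact Nat.lt_succ_of_le (hmin _ ⟨[t], b', by simp, by simpa using hbt, rfl⟩)
  have hnd : ∀ x, (x = s ∨ x = t) → ¬ gen M x ∣ c := by
    rintro x hx ⟨d, rfl⟩
    have := hmin _ ⟨l ++ [x], d, ?_, by simpa [mul_assoc] using hlc, rfl⟩
    · rw [length_gen_mul] at this
      omega
    · simp only [List.mem_append, List.mem_singleton]
      rintro y (hy | rfl)
      exacts [hl y hy, hx]
  have hsl : ¬ gen M s ∣ ofWord M l := fun h => hb (hlc ▸ h.mul_right c)
  obtain ⟨j, hj, hPj⟩ := exists_of_no_delta hsymm P_one P_mul hP l.length s t hst l le_rfl hl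
    (by
      intro h
      obtain ⟨l', rfl⟩ : ∃ l', l = s :: l' := by
        cases l with
        | nil => simp at h
        | cons y l' => simp at h; exact ⟨l', by rw [h]⟩
      exact hsl ⟨_, ofWord_cons s l'⟩)
    (by
      intro hm u d hu h
      obtain ⟨e, he⟩ := exists_ofWord_mul_delta hst hm hu
      obtain ⟨m, hm'⟩ := Nat.exists_eq_succ_of_ne_zero hm
      apply hsl
      rw [h, he, hm', altProd_succ, mul_assoc, mul_assoc]
      exact ⟨_, rfl⟩) i hs
  obtain ⟨j', hj'⟩ := ih _ hcb c j (hnd _ hj) rfl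
  exact ⟨j', hlc ▸ P_mul _ _ _ _ _ hPj hj'⟩

end Positivity

end ArtinMonoid

section Roots

variable {J : Type*}

/-- The data carried by a positive root: its coordinates `β`, its products `p` with the simple
roots, the values `z` entering the linear representation, and its height `h`. -/
@[ext] structure ArtinRoot (J : Type*) where
  β : J → ℤ
  p : J → ℤ
  z : J → ℚ
  h : ℤ

namespace ArtinRoot

variable (G : SimpleGraph J)

open scoped Classical in
/-- The simple reflection attached to `t`. -/
noncomputable def refl (t : J) (x : ArtinRoot J) : ArtinRoot J where
  β := fun s => if s = t then x.β t - x.p t else x.β s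
  p := fun s => if s = t then -x.p t else if G.Adj t s then x.p s + x.p t else x.p s
  z := fun s => if s = t then -4 * x.z t else if G.Adj t s then x.z s + 2 * x.z t else x.z s
  h := x.h - x.p t

open scoped Classical in
/-- The inverse of `ArtinRoot.refl`. -/
noncomputable def low (t : J) (x : ArtinRoot J) : ArtinRoot J where
  β := (refl G t x).β
  p := (refl G t x).p
  z := fun s => if s = t then -x.z t / 4 else if G.Adj t s then x.z s + x.z t / 2 else x.z s
  h := (refl G t x).h

open scoped Classical in
/-- The simple root attached to `t`. -/
noncomputable def simple (t : J) : ArtinRoot J where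
  β := fun s => if s = t then 1 else 0
  p := fun s => if s = t then 2 else if G.Adj t s then -1 else 0
  z := fun s => if s = t then -6 else if G.Adj t s then 1 else -1
  h := 1

variable {G} {s t : J} (x : ArtinRoot J)

@[simp] lemma refl_p_self : (refl G t x).p t = -x.p t := by simp [refl]

@[simp] lemma refl_z_self : (refl G t x).z t = -4 * x.z t := by simp [refl]

lemma refl_p_adj (h : G.Adj t s) : (refl G t x).p s = x.p s + x.p t := by
  simp [refl, h, h.ne']

lemma refl_z_adj (h : G.Adj t s) : (refl G t x).z s = x.z s + 2 * x.z t := by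
  simp [refl, h, h.ne']

lemma refl_p_nonadj (hs : s ≠ t) (h : ¬ G.Adj t s) : (refl G t x).p s = x.p s := by
  simp [refl, h, hs]

lemma refl_z_nonadj (hs : s ≠ t) (h : ¬ G.Adj t s) : (refl G t x).z s = x.z s := by
  simp [refl, h, hs]

lemma simple_p_self : (simple G t).p t = 2 := by simp [simple]

lemma simple_p_adj (h : G.Adj t s) : (simple G t).p s = -1 := by simp [simple, h, h.ne']

lemma simple_p_nonadj (hs : s ≠ t) (h : ¬ G.Adj t s) : (simple G t).p s = 0 := by
  simp [simple, h, hs]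

lemma simple_z_adj (h : G.Adj t s) : (simple G t).z s = 1 := by simp [simple, h, h.ne']

lemma simple_z_nonadj (hs : s ≠ t) (h : ¬ G.Adj t s) : (simple G t).z s = -1 := by
  simp [simple, h, hs]

lemma low_refl : low G t (refl G t x) = x := by
  ext r
  · by_cases hr : r = t <;> simp [low, refl, hr]
  · by_cases hr : r = t <;> by_cases ha : G.Adj t r <;> simp [low, refl, hr, ha]
  · by_cases hr : r = t <;> by_cases ha : G.Adj t r <;> simp [low, refl, hr, ha] <;> ring
  · simp [low, refl]

lemma refl_comm (hst : s ≠ t) (h : ¬ G.Adj s t) :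
    refl G s (refl G t x) = refl G t (refl G s x) := by
  have h' : ¬ G.Adj t s := fun h' => h h'.symm
  ext r
  · by_cases hs : r = s
    · subst hs; simp [refl, h, h', hst, hst.symm]
    by_cases ht : r = t
    · subst ht; simp [refl, h, h', hst, hst.symm]
    simp [refl, hs, ht]
  · by_cases hs : r = s
    · subst hs; simp [refl, h, h', hst]
    by_cases ht : r = t
    · subst ht; simp [refl, h, h', hst.symm]
    by_cases h₁ : G.Adj s r <;> by_cases h₂ : G.Adj t r <;>
      simp [refl, hs, ht, h, h', hst, hst.symm, h₁, h₂] <;> ring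
  · by_cases hs : r = s
    · subst hs; simp [refl, h, h', hst]
    by_cases ht : r = t
    · subst ht; simp [refl, h, h', hst.symm]
    by_cases h₁ : G.Adj s r <;> by_cases h₂ : G.Adj t r <;>
      simp [refl, hs, ht, h, h', hst, hst.symm, h₁, h₂] <;> ring
  · simp [refl, h, h', hst, hst.symm]; ring

lemma refl_braid (h : G.Adj s t) :
    refl G s (refl G t (refl G s x)) = refl G t (refl G s (refl G t x)) := by
  have h' := h.symm
  have hst := h.ne
  ext r
  · by_cases hs : r = s
    · subst hs; simp [refl, h, h', hst, hst.symm]; ring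
    by_cases ht : r = t
    · subst ht; simp [refl, h, h', hst, hst.symm]; ring
    simp [refl, hs, ht]
  · by_cases hs : r = s
    · subst hs; simp [refl, h, h', hst, hst.symm]
    by_cases ht : r = t
    · subst ht; simp [refl, h, h', hst, hst.symm]
    by_cases h₁ : G.Adj s r <;> by_cases h₂ : G.Adj t r <;>
      simp [refl, hs, ht, h, h', hst, hst.symm, h₁, h₂] <;> ring
  · by_cases hs : r = s
    · subst hs; simp [refl, h, h', hst, hst.symm]; ring
    by_cases ht : r = t
    · subst ht; simp [refl, h, h', hst, hst.symm]; ring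
    by_cases h₁ : G.Adj s r <;> by_cases h₂ : G.Adj t r <;>
      simp [refl, hs, ht, h, h', hst, hst.symm, h₁, h₂] <;> ring
  · simp [refl, h, h', hst, hst.symm]; ring

lemma refl_simple (h : G.Adj s t) : refl G t (simple G s) = refl G s (simple G t) := by
  have h' := h.symm
  have hst := h.ne
  ext r
  · by_cases hs : r = s
    · subst hs; simp [refl, simple, h, h', hst, hst.symm]
    by_cases ht : r = t
    · subst ht; simp [refl, simple, h, h', hst, hst.symm]
    simp [refl, simple, hs, ht]
  · by_cases hs : r = s
    · subst hs; simp [refl, simple, h, h', hst, hst.symm]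
    by_cases ht : r = t
    · subst ht; simp [refl, simple, h, h', hst, hst.symm]
    by_cases h₁ : G.Adj s r <;> by_cases h₂ : G.Adj t r <;>
      simp [refl, simple, hs, ht, h, h', hst, hst.symm, h₁, h₂]
  · by_cases hs : r = s
    · subst hs; simp [refl, simple, h, h', hst, hst.symm]; norm_num
    by_cases ht : r = t
    · subst ht; simp [refl, simple, h, h', hst, hst.symm]; norm_num
    by_cases h₁ : G.Adj s r <;> by_cases h₂ : G.Adj t r <;>
      simp [refl, simple, hs, ht, h, h', hst, hst.symm, h₁, h₂] <;> norm_num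
  · simp [refl, simple, h, h', hst, hst.symm]

variable (G) in
/-- The positive roots. -/
inductive IsRoot : ArtinRoot J → Prop
  | simple (s : J) : IsRoot (simple G s)
  | raise {x : ArtinRoot J} (t : J) (hx : IsRoot x) (ht : x.p t < 0) : IsRoot (refl G t x)

variable {x}

lemma IsRoot.one_le_h (hx : IsRoot G x) : 1 ≤ x.h := by
  induction hx with
  | simple s => exact le_rfl
  | raise t _ ht ih => simp only [refl]; omega

lemma IsRoot.refl_ne_simple (hx : IsRoot G x) (ht : x.p t < 0) :
    refl G t x ≠ ArtinRoot.simple G s := by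
  intro h
  have h₁ := congrArg ArtinRoot.h h
  have h₂ := hx.one_le_h
  simp only [refl, ArtinRoot.simple] at h₁
  omega

lemma IsRoot.exists_eq_refl (hx : IsRoot G x) (hs : 0 < x.p s) (hne : x ≠ ArtinRoot.simple G s) :
    ∃ y, IsRoot G y ∧ y.p s < 0 ∧ x = refl G s y := by
  induction hn : x.h.toNat using Nat.strong_induction_on generalizing x s with
  | _ n ih =>
  subst hn
  cases hx with
  | simple t =>
    have hts : s ≠ t := by
      rintro rfl
      exact hne rfl
    by_cases h : G.Adj t s
    · rw [simple_p_adj h] at hs; omega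
    · rw [simple_p_nonadj hts h] at hs; omega
  | @raise y t hy ht =>
    have hhy := hy.one_le_h
    have hlt : y.h.toNat < (refl G t y).h.toNat := by simp only [refl]; omega
    by_cases hst : s = t
    · subst hst
      exact ⟨y, hy, ht, rfl⟩
    by_cases h : G.Adj t s
    · rw [refl_p_adj _ h] at hs
      by_cases hys : y = ArtinRoot.simple G s
      · subst hys
        exact ⟨ArtinRoot.simple G t, .simple t, by rw [simple_p_adj h]; norm_num,
          refl_simple h.symm⟩
      obtain ⟨w, hw, hws, rfl⟩ := ih _ hlt hy (by omega) hys rfl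
      have hhw := hw.one_le_h
      have hlt' : w.h.toNat < (refl G s w).h.toNat := by simp only [refl]; omega
      rw [refl_p_adj _ h.symm] at ht hs
      rw [refl_p_self] at hs
      have hwt : w ≠ ArtinRoot.simple G t := by
        rintro rfl
        rw [simple_p_self, simple_p_adj h] at ht
        omega
      obtain ⟨v, hv, hvt, rfl⟩ := ih _ (hlt'.trans hlt) hw (by omega) hwt rfl
      rw [refl_p_adj _ h, refl_p_self] at ht
      have hr : IsRoot G (refl G s v) := hv.raise s (by omega)
      refine ⟨refl G t (refl G s v), hr.raise t ?_, ?_, refl_braid _ h⟩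
      · rw [refl_p_adj _ h.symm]; omega
      · rw [refl_p_adj _ h, refl_p_self, refl_p_adj _ h.symm]; omega
    · have h' : ¬ G.Adj s t := fun h' => h h'.symm
      rw [refl_p_nonadj _ hst h] at hs
      have hys : y ≠ ArtinRoot.simple G s := by
        rintro rfl
        rw [simple_p_nonadj (Ne.symm hst) h'] at ht
        omega
      obtain ⟨w, hw, hws, rfl⟩ := ih _ hlt hy hs hys rfl
      rw [refl_p_nonadj _ (Ne.symm hst) h'] at ht
      exact ⟨refl G t w, hw.raise t ht, by rwa [refl_p_nonadj _ hst h],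
        refl_comm _ (Ne.symm hst) h⟩

lemma IsRoot.z_eq (htf : ∀ a b c, G.Adj a b → G.Adj b c → ¬ G.Adj a c) (hx : IsRoot G x)
    (hst : G.Adj s t) (hs : x.p s = 0) (ht : x.p t = 0) : x.z s = x.z t := by
  induction hn : x.h.toNat using Nat.strong_induction_on generalizing x s t with
  | _ n ih =>
  subst hn
  cases hx with
  | simple r =>
    have key : ∀ {s}, (ArtinRoot.simple G r).p s = 0 → (ArtinRoot.simple G r).z s = -1 := by
      intro s h
      simp only [ArtinRoot.simple] at h ⊢
      split_ifs at h ⊢ <;> simp_all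
    rw [key hs, key ht]
  | @raise y r hy hr =>
    have hhy := hy.one_le_h
    have hlt : y.h.toNat < (refl G r y).h.toNat := by simp only [refl]; omega
    have hrs : s ≠ r := by
      rintro rfl
      rw [refl_p_self] at hs; omega
    have hrt : t ≠ r := by
      rintro rfl
      rw [refl_p_self] at ht; omega
    have key : ∀ {s t}, G.Adj s t → (refl G r y).p s = 0 → (refl G r y).p t = 0 → t ≠ r →
        G.Adj r s → (refl G r y).z s = (refl G r y).z t := by
      intro s t hst hs ht hrt hadj
      have hadj' : ¬ G.Adj r t := htf r s t hadj hst
      rw [refl_p_adj _ hadj] at hs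
      rw [refl_p_nonadj _ hrt hadj'] at ht
      have hys : y ≠ ArtinRoot.simple G s := by
        rintro rfl
        rw [simple_p_adj hst] at ht
        omega
      obtain ⟨w, hw, hws, rfl⟩ := hy.exists_eq_refl (s := s) (by omega) hys
      have hhw := hw.one_le_h
      have hlt' : w.h.toNat < (refl G s w).h.toNat := by simp only [refl]; omega
      rw [refl_p_adj _ hst] at ht
      rw [refl_p_self, refl_p_adj _ hadj.symm] at hs
      have hwt : w ≠ ArtinRoot.simple G t := by
        rintro rfl
        rw [simple_p_self, simple_p_adj hst.symm] at ht
        omega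
      obtain ⟨v, hv, hvt, rfl⟩ := hw.exists_eq_refl (s := t) (by omega) hwt
      have hhv := hv.one_le_h
      have hlt'' : v.h.toNat < (refl G t v).h.toNat := by simp only [refl]; omega
      have hadj'' : ¬ G.Adj t r := fun h => hadj' h.symm
      rw [refl_p_self, refl_p_adj _ hst.symm] at ht
      rw [refl_p_adj _ hst.symm, refl_p_nonadj _ hrt.symm hadj''] at hs
      have hz := ih _ (hlt''.trans (hlt'.trans hlt)) hv hadj (by omega) (by omega) rfl
      rw [refl_z_adj _ hadj, refl_z_nonadj _ hrt hadj', refl_z_self, refl_z_adj _ hadj.symm,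
        refl_z_adj _ hst, refl_z_adj _ hst.symm, refl_z_self, refl_z_nonadj _ hrt.symm hadj'', hz]
      ring
    by_cases h₁ : G.Adj r s
    · exact key hst hs ht hrt h₁
    by_cases h₂ : G.Adj r t
    · exact (key hst.symm ht hs hrs h₂).symm
    rw [refl_p_nonadj _ hrs h₁] at hs
    rw [refl_p_nonadj _ hrt h₂] at ht
    rw [refl_z_nonadj _ hrs h₁, refl_z_nonadj _ hrt h₂]
    exact ih _ hlt hy hst hs ht rfl

end ArtinRoot

end Roots

section Representation

namespace ArtinRoot

variable {J : Type*} (G : SimpleGraph J) (θ : ℚ)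

/-- The basis vector attached to `x`. -/
noncomputable abbrev e (x : ArtinRoot J) : ArtinRoot J →₀ ℚ := Finsupp.single x 1

open scoped Classical in
/-- The image of a basis vector under the operator `ArtinRoot.op`. -/
noncomputable def opBasis (s : J) (x : ArtinRoot J) : ArtinRoot J →₀ ℚ :=
  if IsRoot G x then
    if x = simple G s then θ • e x
    else if x.p s < 0 then
      (1 / 2 : ℚ) • e x + (1 / 2 : ℚ) • e (refl G s x) + (θ * (x.z s - 1)) • e (simple G s)
    else if x.p s = 0 then e x + (θ * (-x.z s - 1)) • e (simple G s)
    else e (low G s x) - θ • e (simple G s)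
  else e x

/-- The operator representing the generator `s` in the Lawrence-Krammer-Paris representation. -/
noncomputable def op (s : J) : Module.End ℚ (ArtinRoot J →₀ ℚ) :=
  Finsupp.linearCombination ℚ (opBasis G θ s)

variable {G} {s t : J} {x : ArtinRoot J}

lemma op_e (s : J) (x : ArtinRoot J) : op G θ s (e x) = opBasis G θ s x := by
  simp [op, e]

lemma op_of_not (hx : ¬ IsRoot G x) (s : J) : op G θ s (e x) = e x := by
  rw [op_e, opBasis, if_neg hx]

lemma op_simple (s : J) : op G θ s (e (simple G s)) = θ • e (simple G s) := by
  rw [op_e, opBasis, if_pos (.simple s), if_pos rfl]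

lemma op_neg (hx : IsRoot G x) (h : x.p s < 0) :
    op G θ s (e x) = (1 / 2 : ℚ) • e x + (1 / 2 : ℚ) • e (refl G s x) +
      (θ * (x.z s - 1)) • e (simple G s) := by
  rw [op_e, opBasis, if_pos hx, if_neg, if_pos h]
  rintro rfl
  rw [simple_p_self] at h
  omega

lemma op_zero (hx : IsRoot G x) (h : x.p s = 0) :
    op G θ s (e x) = e x + (θ * (-x.z s - 1)) • e (simple G s) := by
  rw [op_e, opBasis, if_pos hx, if_neg, if_neg (by omega), if_pos h]
  rintro rfl
  rw [simple_p_self] at h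
  omega

lemma op_refl (hx : IsRoot G x) (h : x.p s < 0) :
    op G θ s (e (refl G s x)) = e x - θ • e (simple G s) := by
  rw [op_e, opBasis, if_pos (hx.raise s h), if_neg (hx.refl_ne_simple h), refl_p_self,
    if_neg (by omega), if_neg (by omega), low_refl]

lemma op_simple_nonadj (hst : s ≠ t) (h : ¬ G.Adj s t) :
    op G θ t (e (simple G s)) = e (simple G s) := by
  rw [op_zero θ (.simple s) (simple_p_nonadj hst.symm h), simple_z_nonadj hst.symm h]
  simp

lemma op_simple_adj (h : G.Adj s t) :
    op G θ t (e (simple G s)) =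
      (1 / 2 : ℚ) • e (simple G s) + (1 / 2 : ℚ) • e (refl G t (simple G s)) := by
  rw [op_neg θ (.simple s) (by rw [simple_p_adj h]; norm_num), simple_z_adj h]
  simp

lemma op_refl_simple (h : G.Adj s t) :
    op G θ t (e (refl G t (simple G s))) = e (simple G s) - θ • e (simple G t) :=
  op_refl θ (.simple s) (by rw [simple_p_adj h]; norm_num)

lemma op_refl_simple' (h : G.Adj s t) :
    op G θ s (e (refl G t (simple G s))) = e (simple G t) - θ • e (simple G s) := by
  rw [refl_simple h]
  exact op_refl_simple θ h.symm

/-- The orbit of a root under two commuting reflections has a bottom element. -/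
lemma IsRoot.exists_bottom_comm (hst : s ≠ t) (h : ¬ G.Adj s t) (hx : IsRoot G x) :
    x = ArtinRoot.simple G s ∨ x = ArtinRoot.simple G t ∨ ∃ y, IsRoot G y ∧ y.p s ≤ 0 ∧ y.p t ≤ 0 ∧
      (x = y ∨ (y.p s < 0 ∧ x = refl G s y) ∨ (y.p t < 0 ∧ x = refl G t y) ∨
        (y.p s < 0 ∧ y.p t < 0 ∧ x = refl G s (refl G t y))) := by
  have h' : ¬ G.Adj t s := fun h' => h h'.symm
  by_cases hxs : x = ArtinRoot.simple G s
  · exact Or.inl hxs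
  by_cases hxt : x = ArtinRoot.simple G t
  · exact Or.inr (Or.inl hxt)
  refine Or.inr (Or.inr ?_)
  by_cases h₁ : 0 < x.p s
  · obtain ⟨y, hy, hys, rfl⟩ := hx.exists_eq_refl h₁ hxs
    by_cases h₂ : 0 < y.p t
    · have hyt : y ≠ ArtinRoot.simple G t := by
        rintro rfl
        rw [simple_p_nonadj hst h'] at hys
        omega
      obtain ⟨w, hw, hwt, rfl⟩ := hy.exists_eq_refl h₂ hyt
      rw [refl_p_nonadj _ hst h'] at hys
      exact ⟨w, hw, hys.le, hwt.le, Or.inr (Or.inr (Or.inr ⟨hys, hwt, rfl⟩))⟩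
    · exact ⟨y, hy, hys.le, by omega, Or.inr (Or.inl ⟨hys, rfl⟩)⟩
  · by_cases h₂ : 0 < x.p t
    · obtain ⟨y, hy, hyt, rfl⟩ := hx.exists_eq_refl h₂ hxt
      rw [refl_p_nonadj _ hst h'] at h₁
      exact ⟨y, hy, by omega, hyt.le, Or.inr (Or.inr (Or.inl ⟨hyt, rfl⟩))⟩
    · exact ⟨x, hx, by omega, by omega, Or.inl rfl⟩

lemma op_comm (hst : s ≠ t) (h : ¬ G.Adj s t) : Commute (op G θ s) (op G θ t) := by
  have h' : ¬ G.Adj t s := fun h' => h h'.symm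
  refine Finsupp.lhom_ext' fun x => LinearMap.ext_ring ?_
  change op G θ s (op G θ t (e x)) = op G θ t (op G θ s (e x))
  by_cases hx : IsRoot G x
  swap
  · simp only [op_of_not θ hx]
  have est := op_simple_nonadj θ hst h
  have ets := op_simple_nonadj θ hst.symm h'
  rcases hx.exists_bottom_comm hst h with rfl | rfl | ⟨y, hy, hs, ht, hxy⟩
  · simp only [est, op_simple, map_smul]
  · simp only [ets, op_simple, map_smul]
  clear hx
  rcases hs.lt_or_eq with hs | hs <;> rcases ht.lt_or_eq with ht | ht
  · have hys := hy.raise s hs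
    have hyt := hy.raise t ht
    have ps : (refl G s y).p t < 0 := by rwa [refl_p_nonadj _ hst.symm h]
    have pt : (refl G t y).p s < 0 := by rwa [refl_p_nonadj _ hst h']
    have a₀ := op_neg θ hy hs
    have a₁ := op_refl θ hy hs
    have a₂ := op_neg θ hyt pt
    have a₃ := op_refl θ hyt pt
    have b₀ := op_neg θ hy ht
    have b₁ := op_refl θ hy ht
    have b₂ := op_neg θ hys ps
    have b₃ := op_refl θ hys ps
    rw [refl_z_nonadj _ hst h'] at a₂
    rw [refl_z_nonadj _ hst.symm h] at b₂
    rw [← refl_comm _ hst h] at b₂ b₃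
    rcases hxy with rfl | ⟨-, rfl⟩ | ⟨-, rfl⟩ | ⟨-, -, rfl⟩ <;>
    · simp only [a₀, a₁, a₂, a₃, b₀, b₁, b₂, b₃, est, ets, map_add, map_sub, map_smul]
      module
  · have hys := hy.raise s hs
    have ps : (refl G s y).p t = 0 := by rwa [refl_p_nonadj _ hst.symm h]
    have a₀ := op_neg θ hy hs
    have a₁ := op_refl θ hy hs
    have b₀ := op_zero θ hy ht
    have b₁ := op_zero θ hys ps
    rw [refl_z_nonadj _ hst.symm h] at b₁
    rcases hxy with rfl | ⟨-, rfl⟩ | ⟨h₁, -⟩ | ⟨-, h₁, -⟩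
    any_goals omega
    all_goals
      simp only [a₀, a₁, b₀, b₁, est, ets, map_add, map_sub, map_smul]
      module
  · have hyt := hy.raise t ht
    have pt : (refl G t y).p s = 0 := by rwa [refl_p_nonadj _ hst h']
    have a₀ := op_zero θ hy hs
    have a₁ := op_zero θ hyt pt
    have b₀ := op_neg θ hy ht
    have b₁ := op_refl θ hy ht
    rw [refl_z_nonadj _ hst h'] at a₁
    rcases hxy with rfl | ⟨h₁, -⟩ | ⟨-, rfl⟩ | ⟨h₁, -⟩
    any_goals omega
    all_goals
      simp only [a₀, a₁, b₀, b₁, est, ets, map_add, map_sub, map_smul]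
      module
  · have a₀ := op_zero θ hy hs
    have b₀ := op_zero θ hy ht
    rcases hxy with rfl | ⟨h₁, -⟩ | ⟨h₁, -⟩ | ⟨h₁, -⟩
    any_goals omega
    simp only [a₀, b₀, est, ets, map_add, map_smul]
    module

/-- The orbit of a root under two braided reflections has a bottom element. -/
lemma IsRoot.exists_bottom_braid (h : G.Adj s t) (hx : IsRoot G x) (hs : 0 < x.p s) :
    x = ArtinRoot.simple G s ∨ x = refl G t (ArtinRoot.simple G s) ∨
      ∃ y, IsRoot G y ∧ y.p s ≤ 0 ∧ y.p t ≤ 0 ∧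
      ((y.p s < 0 ∧ x = refl G s y) ∨ (y.p t < 0 ∧ x = refl G s (refl G t y)) ∨
        (y.p s < 0 ∧ y.p t < 0 ∧ x = refl G s (refl G t (refl G s y)))) := by
  by_cases hxs : x = ArtinRoot.simple G s
  · exact Or.inl hxs
  refine Or.inr ?_
  obtain ⟨y, hy, hys, rfl⟩ := hx.exists_eq_refl hs hxs
  by_cases hyt : 0 < y.p t
  swap
  · exact Or.inr ⟨y, hy, hys.le, by omega, Or.inl ⟨hys, rfl⟩⟩
  by_cases hyt' : y = ArtinRoot.simple G t
  · exact Or.inl (by rw [hyt', refl_simple h])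
  refine Or.inr ?_
  obtain ⟨w, hw, hwt, rfl⟩ := hy.exists_eq_refl hyt hyt'
  rw [refl_p_adj _ h.symm] at hys
  by_cases hws : 0 < w.p s
  swap
  · exact ⟨w, hw, by omega, hwt.le, Or.inr (Or.inl ⟨hwt, rfl⟩)⟩
  have hws' : w ≠ ArtinRoot.simple G s := by
    rintro rfl
    rw [simple_p_self, simple_p_adj h] at hys
    omega
  obtain ⟨v, hv, hvs, rfl⟩ := hw.exists_eq_refl hws hws'
  rw [refl_p_self, refl_p_adj _ h] at hys
  exact ⟨v, hv, hvs.le, by omega, Or.inr (Or.inr ⟨hvs, by omega, rfl⟩)⟩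

/-- A root on which the braid relation holds between two operators. -/
def BraidAt (G : SimpleGraph J) (θ : ℚ) (s t : J) (x : ArtinRoot J) : Prop :=
  op G θ s (op G θ t (op G θ s (e x))) = op G θ t (op G θ s (op G θ t (e x)))

lemma braidAt_simple (h : G.Adj s t) :
    BraidAt G θ s t (simple G s) ∧ BraidAt G θ s t (refl G t (simple G s)) := by
  have e₁ := op_simple_adj θ h
  have e₂ := op_simple_adj θ h.symm
  have e₃ := op_refl_simple θ h
  have e₄ := op_refl_simple' θ h
  rw [← refl_simple h] at e₂
  constructor <;>
  · simp only [BraidAt, e₁, e₂, e₃, e₄, op_simple, map_add, map_sub, map_smul]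
    module

lemma braidAt_neg_neg (h : G.Adj s t) (hx : IsRoot G x) (hs : x.p s < 0) (ht : x.p t < 0) :
    BraidAt G θ s t x ∧ BraidAt G θ s t (refl G s x) ∧
      BraidAt G θ s t (refl G s (refl G t x)) ∧
      BraidAt G θ s t (refl G s (refl G t (refl G s x))) := by
  have e₁ := op_simple_adj θ h
  have e₂ := op_simple_adj θ h.symm
  have e₃ := op_refl_simple θ h
  have e₄ := op_refl_simple' θ h
  rw [← refl_simple h] at e₂
  have hxs := hx.raise s hs
  have hxt := hx.raise t ht
  have ps : (refl G s x).p t < 0 := by rw [refl_p_adj _ h]; omega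
  have pt : (refl G t x).p s < 0 := by rw [refl_p_adj _ h.symm]; omega
  have hxst := hxs.raise t ps
  have hxts := hxt.raise s pt
  have ps' : (refl G t (refl G s x)).p s < 0 := by
    rw [refl_p_adj _ h.symm, refl_p_self, refl_p_adj _ h]; omega
  have pt' : (refl G s (refl G t x)).p t < 0 := by
    rw [refl_p_adj _ h, refl_p_self, refl_p_adj _ h.symm]; omega
  have a₀ := op_neg θ hx hs
  have a₁ := op_refl θ hx hs
  have a₂ := op_neg θ hxt pt
  have a₃ := op_refl θ hxt pt
  have a₄ := op_neg θ hxst ps'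
  have a₅ := op_refl θ hxst ps'
  have b₀ := op_neg θ hx ht
  have b₁ := op_refl θ hx ht
  have b₂ := op_neg θ hxs ps
  have b₃ := op_refl θ hxs ps
  have b₄ := op_neg θ hxts pt'
  have b₅ := op_refl θ hxts pt'
  rw [refl_z_adj _ h.symm] at a₂
  rw [refl_z_adj _ h.symm, refl_z_self, refl_z_adj _ h] at a₄
  rw [refl_z_adj _ h] at b₂
  rw [refl_z_adj _ h, refl_z_self, refl_z_adj _ h.symm, ← refl_braid _ h] at b₄
  rw [← refl_braid _ h] at b₅
  refine ⟨?_, ?_, ?_, ?_⟩ <;>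
  · simp only [BraidAt, e₁, e₂, e₃, e₄, op_simple, a₀, a₁, a₂, a₃, a₄, a₅, b₀, b₁, b₂, b₃, b₄, b₅,
      map_add, map_sub, map_smul]
    module

lemma braidAt_neg_zero (h : G.Adj s t) (hx : IsRoot G x) (hs : x.p s < 0) (ht : x.p t = 0) :
    BraidAt G θ s t x ∧ BraidAt G θ s t (refl G s x) ∧
      BraidAt G θ s t (refl G t (refl G s x)) := by
  have e₁ := op_simple_adj θ h
  have e₂ := op_simple_adj θ h.symm
  have e₃ := op_refl_simple θ h
  have e₄ := op_refl_simple' θ h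
  rw [← refl_simple h] at e₂
  have hxs := hx.raise s hs
  have ps : (refl G s x).p t < 0 := by rw [refl_p_adj _ h]; omega
  have hxst := hxs.raise t ps
  have ps' : (refl G t (refl G s x)).p s = 0 := by
    rw [refl_p_adj _ h.symm, refl_p_self, refl_p_adj _ h]; omega
  have a₀ := op_neg θ hx hs
  have a₁ := op_refl θ hx hs
  have a₂ := op_zero θ hxst ps'
  have b₀ := op_zero θ hx ht
  have b₁ := op_neg θ hxs ps
  have b₂ := op_refl θ hxs ps
  rw [refl_z_adj _ h.symm, refl_z_self, refl_z_adj _ h] at a₂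
  rw [refl_z_adj _ h] at b₁
  refine ⟨?_, ?_, ?_⟩ <;>
  · simp only [BraidAt, e₁, e₂, e₃, e₄, op_simple, a₀, a₁, a₂, b₀, b₁, b₂,
      map_add, map_sub, map_smul]
    module

lemma braidAt_zero_zero (htf : ∀ a b c, G.Adj a b → G.Adj b c → ¬ G.Adj a c)
    (h : G.Adj s t) (hx : IsRoot G x) (hs : x.p s = 0) (ht : x.p t = 0) :
    BraidAt G θ s t x := by
  have e₁ := op_simple_adj θ h
  have e₂ := op_simple_adj θ h.symm
  have e₃ := op_refl_simple θ h
  have e₄ := op_refl_simple' θ h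
  rw [← refl_simple h] at e₂
  have a₀ := op_zero θ hx hs
  have b₀ := op_zero θ hx ht
  rw [hx.z_eq htf h hs ht] at a₀
  simp only [BraidAt, e₁, e₂, e₃, e₄, op_simple, a₀, b₀, map_add, map_smul]
  module

lemma braidAt_of_pos (h : G.Adj s t) (hx : IsRoot G x) (hs : 0 < x.p s) :
    BraidAt G θ s t x := by
  rcases hx.exists_bottom_braid h hs with rfl | rfl | ⟨y, hy, hys, hyt, hxy⟩
  · exact (braidAt_simple θ h).1
  · exact (braidAt_simple θ h).2
  rcases hys.lt_or_eq with hys | hys <;> rcases hyt.lt_or_eq with hyt | hyt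
  · have := braidAt_neg_neg θ h hy hys hyt
    rcases hxy with ⟨-, rfl⟩ | ⟨-, rfl⟩ | ⟨-, -, rfl⟩
    exacts [this.2.1, this.2.2.1, this.2.2.2]
  · rcases hxy with ⟨-, rfl⟩ | ⟨h₁, -⟩ | ⟨-, h₁, -⟩
    · exact (braidAt_neg_zero θ h hy hys hyt).2.1
    all_goals omega
  · rcases hxy with ⟨h₁, -⟩ | ⟨-, rfl⟩ | ⟨h₁, -⟩
    · omega
    · exact (braidAt_neg_zero θ h.symm hy hyt hys).2.2.symm
    · omega
  · omega

lemma op_braid (htf : ∀ a b c, G.Adj a b → G.Adj b c → ¬ G.Adj a c) (h : G.Adj s t) :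
    op G θ s * op G θ t * op G θ s = op G θ t * op G θ s * op G θ t := by
  refine Finsupp.lhom_ext' fun x => LinearMap.ext_ring ?_
  change BraidAt G θ s t x
  by_cases hx : IsRoot G x
  swap
  · simp only [BraidAt, op_of_not θ hx]
  rcases lt_trichotomy (x.p s) 0 with hs | hs | hs
  · rcases lt_trichotomy (x.p t) 0 with ht | ht | ht
    · exact (braidAt_neg_neg θ h hx hs ht).1
    · exact (braidAt_neg_zero θ h hx hs ht).1
    · exact (braidAt_of_pos θ h.symm hx ht).symm
  · rcases lt_trichotomy (x.p t) 0 with ht | ht | ht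
    · exact (braidAt_neg_zero θ h.symm hx ht hs).1.symm
    · exact braidAt_zero_zero θ htf h hx hs ht
    · exact (braidAt_of_pos θ h.symm hx ht).symm
  · exact braidAt_of_pos θ h hx hs

lemma op_cubic (s : J) :
    op G θ s * op G θ s * op G θ s - (θ + 1 / 2) • (op G θ s * op G θ s) +
      ((θ - 1) / 2) • op G θ s = -(θ / 2) • 1 := by
  refine Finsupp.lhom_ext' fun x => LinearMap.ext_ring ?_
  change op G θ s (op G θ s (op G θ s (e x))) - (θ + 1 / 2) • op G θ s (op G θ s (e x)) +
    ((θ - 1) / 2) • op G θ s (e x) = -(θ / 2) • e x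
  by_cases hx : IsRoot G x
  swap
  · simp only [op_of_not θ hx]
    module
  by_cases hxs : x = simple G s
  · subst hxs
    simp only [op_simple, map_smul]
    module
  rcases lt_trichotomy (x.p s) 0 with hs | hs | hs
  · simp only [op_neg θ hx hs, op_refl θ hx hs, op_simple, map_add, map_sub, map_smul]
    module
  · simp only [op_zero θ hx hs, op_simple, map_add, map_smul]
    module
  · obtain ⟨y, hy, hys, rfl⟩ := hx.exists_eq_refl hs hxs
    simp only [op_neg θ hy hys, op_refl θ hy hys, op_simple, map_add, map_sub, map_smul]
    module

variable {θ}

/-- The operator `ArtinRoot.op`, for a nonzero parameter, as a unit. -/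
noncomputable def opUnit (hθ : θ ≠ 0) (G : SimpleGraph J) (s : J) :
    (Module.End ℚ (ArtinRoot J →₀ ℚ))ˣ where
  val := op G θ s
  inv := (-(2 / θ)) • (op G θ s * op G θ s - (θ + 1 / 2) • op G θ s + ((θ - 1) / 2) • 1)
  val_inv := by
    have h := congrArg (fun T => (-(2 / θ)) • T) (op_cubic (G := G) θ s)
    simp only [smul_smul, show -(2 / θ) * -(θ / 2) = 1 by field_simp, one_smul] at h
    refine Eq.trans ?_ h
    rw [mul_smul_comm]
    congr 1
    simp only [mul_add, mul_sub, mul_smul_comm, mul_one, mul_assoc]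
  inv_val := by
    have h := congrArg (fun T => (-(2 / θ)) • T) (op_cubic (G := G) θ s)
    simp only [smul_smul, show -(2 / θ) * -(θ / 2) = 1 by field_simp, one_smul] at h
    refine Eq.trans ?_ h
    rw [smul_mul_assoc]
    congr 1

lemma op_affine (θ : ℚ) (s : J) : op G θ s = op G 0 s + θ • (op G 1 s - op G 0 s) := by
  refine Finsupp.lhom_ext' fun x => LinearMap.ext_ring ?_
  change op G θ s (e x) = op G 0 s (e x) + θ • (op G 1 s (e x) - op G 0 s (e x))
  simp only [op_e, opBasis]
  split_ifs <;> module

end ArtinRoot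

end Representation

section Positivity

variable {X : Type*}

/-- The submonoid of operators whose entries are nonnegative. -/
def nonnegEnd (X : Type*) : Submonoid (Module.End ℚ (X →₀ ℚ)) where
  carrier := {T | ∀ v : X →₀ ℚ, (∀ x, 0 ≤ v x) → ∀ x, 0 ≤ T v x}
  one_mem' := fun _ hv => hv
  mul_mem' := fun hT hU v hv => hT _ (hU v hv)

lemma end_apply_eq_sum (T : Module.End ℚ (X →₀ ℚ)) (v : X →₀ ℚ) (y : X) :
    T v y = ∑ x ∈ v.support, v x * T (Finsupp.single x 1) y := by
  conv_lhs => rw [← Finsupp.sum_single v, Finsupp.sum, map_sum]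
  rw [Finsupp.finsetSum_apply]
  refine Finset.sum_congr rfl fun x _ => ?_
  rw [← smul_eq_mul, ← Finsupp.smul_apply, ← map_smul, Finsupp.smul_single_one]

lemma mem_nonnegEnd {T : Module.End ℚ (X →₀ ℚ)}
    (h : ∀ x y, 0 ≤ T (Finsupp.single x 1) y) : T ∈ nonnegEnd X := by
  intro v hv y
  rw [end_apply_eq_sum]
  exact Finset.sum_nonneg fun x _ => mul_nonneg (hv x) (h x y)

lemma finsupp_single_nonneg {c : ℚ} (hc : 0 ≤ c) (x y : X) :
    0 ≤ (Finsupp.single x c : X →₀ ℚ) y := by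
  classical
  rw [Finsupp.single_apply]
  split_ifs <;> simp [hc]

/-- The operators `T` for which the entry in row `y` and column `x` is positive. -/
def PosEntry (T : Module.End ℚ (X →₀ ℚ)) (y x : X) : Prop := 0 < T (Finsupp.single x 1) y

lemma PosEntry.mul {T U : Module.End ℚ (X →₀ ℚ)} (hT : T ∈ nonnegEnd X) (hU : U ∈ nonnegEnd X)
    {x y z : X} (h₁ : PosEntry T x y) (h₂ : PosEntry U y z) : PosEntry (T * U) x z := by
  unfold PosEntry at *
  rw [Module.End.mul_apply, end_apply_eq_sum]
  have hv : ∀ w, 0 ≤ U (Finsupp.single z 1) w := hU _ (finsupp_single_nonneg zero_le_one z)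
  refine Finset.sum_pos' (fun w _ => mul_nonneg (hv w)
    (hT _ (finsupp_single_nonneg zero_le_one w) x))
    ⟨y, Finsupp.mem_support_iff.2 h₂.ne', mul_pos h₂ h₁⟩

lemma posEntry_one (x : X) : PosEntry (1 : Module.End ℚ (X →₀ ℚ)) x x := by
  simp [PosEntry]

end Positivity

namespace ArtinRoot

variable {J : Type*} {G : SimpleGraph J} {s t : J} {x : ArtinRoot J}

lemma op_zero_mem_nonnegEnd (s : J) : op G 0 s ∈ nonnegEnd (ArtinRoot J) := by
  refine mem_nonnegEnd fun x y => ?_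
  change 0 ≤ op G 0 s (e x) y
  rw [op_e, opBasis]
  split_ifs <;> simp [e, add_nonneg, finsupp_single_nonneg]

lemma op_zero_apply_simple (s : J) (v : ArtinRoot J →₀ ℚ) : op G 0 s v (simple G s) = 0 := by
  rw [end_apply_eq_sum]
  refine Finset.sum_eq_zero fun x _ => mul_eq_zero_of_right _ ?_
  change op G 0 s (e x) _ = 0
  by_cases hx : IsRoot G x
  swap
  · rw [op_of_not 0 hx, Finsupp.single_eq_of_ne]
    rintro rfl
    exact hx (.simple s)
  by_cases hxs : x = simple G s
  · simp [hxs, op_simple]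
  rcases lt_trichotomy (x.p s) 0 with hs | hs | hs
  · simp [op_neg 0 hx hs, e, Finsupp.single_eq_of_ne (Ne.symm hxs),
      Finsupp.single_eq_of_ne (hx.refl_ne_simple (s := s) hs).symm]
  · simp [op_zero 0 hx hs, e, Finsupp.single_eq_of_ne (Ne.symm hxs)]
  · obtain ⟨y, hy, hys, rfl⟩ := hx.exists_eq_refl hs hxs
    have : simple G s ≠ y := by
      rintro rfl
      rw [simple_p_self] at hys
      omega
    simp [op_refl 0 hy hys, e, Finsupp.single_eq_of_ne this]

lemma exists_posEntry (hx : IsRoot G x) (hxs : x ≠ simple G s) :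
    ∃ y, IsRoot G y ∧ PosEntry (op G 0 s) x y ∧ y.β = (refl G s x).β ∧ y.p = (refl G s x).p := by
  rcases lt_trichotomy (x.p s) 0 with hs | hs | hs
  · refine ⟨refl G s x, hx.raise s hs, ?_, rfl, rfl⟩
    simp [PosEntry, op_refl 0 hx hs]
  · refine ⟨x, hx, ?_, ?_, ?_⟩
    · simp [PosEntry, op_zero 0 hx hs]
    · ext r
      by_cases hr : r = s <;> simp [refl, hr, hs]
    · ext r
      by_cases hr : r = s <;> simp [refl, hr, hs]
  · obtain ⟨y, hy, hys, rfl⟩ := hx.exists_eq_refl hs hxs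
    refine ⟨y, hy, ?_, (congrArg ArtinRoot.β (low_refl (G := G) (t := s) y)).symm,
      (congrArg ArtinRoot.p (low_refl (G := G) (t := s) y)).symm⟩
    have := finsupp_single_nonneg (c := 2⁻¹) (by norm_num) y (refl G s y)
    simp only [PosEntry, op_neg 0 hy hys]
    simp
    linarith

section Monoid

variable {Y : Type*} (G) (ι : Y → J)

open scoped Classical in
/-- The labelling induced by a graph: adjacent vertices are braided, the others commute. -/
noncomputable def label (a b : Y) : ℕ := if G.Adj (ι a) (ι b) then 3 else 2

variable {G ι}

lemma altProd_op (htf : ∀ a b c, G.Adj a b → G.Adj b c → ¬ G.Adj a c) (θ : ℚ)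
    (hι : Function.Injective ι) {a b : Y} (hab : a ≠ b) :
    altProd (op G θ (ι a)) (op G θ (ι b)) (label G ι a b) =
      altProd (op G θ (ι b)) (op G θ (ι a)) (label G ι a b) := by
  unfold label
  split_ifs with h
  · simpa [altProd, mul_assoc] using op_braid θ htf h
  · simpa [altProd] using (op_comm θ (hι.ne hab) h).eq

lemma exists_posEntry_of_not_dvd (hι : Function.Injective ι)
    (φ : ArtinMonoid Y (label G ι) →* Module.End ℚ (ArtinRoot J →₀ ℚ))
    (hφ : ∀ a, φ (ArtinMonoid.gen _ a) = op G 0 (ι a))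
    (b : ArtinMonoid Y (label G ι)) (i : Y) (hb : ¬ ArtinMonoid.gen _ i ∣ b) :
    ∃ j, PosEntry (φ b) (simple G (ι i)) (simple G (ι j)) := by
  have hφ' : ∀ b, φ b ∈ nonnegEnd _ := by
    intro b
    obtain ⟨l, rfl⟩ := ArtinMonoid.exists_ofWord b
    induction l with
    | nil => simp [one_mem]
    | cons a l ih =>
      rw [ArtinMonoid.ofWord_cons, map_mul, hφ]
      exact mul_mem (op_zero_mem_nonnegEnd _) ih
  refine ArtinMonoid.exists_of_not_dvd (τ := fun i => i)
    (P := fun b i j => PosEntry (φ b) (simple G (ι i)) (simple G (ι j))) ?_ ?_ ?_ ?_ b i hb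
  · intro s t _
    classical exact if_congr (G.adj_comm _ _) rfl rfl
  · intro i
    rw [map_one]
    exact posEntry_one _
  · intro a b i j k h₁ h₂
    rw [map_mul]
    exact h₁.mul (hφ' a) (hφ' b) h₂
  · intro s t hst k hk hk' i hi
    change i = s at hi
    subst hi
    refine ⟨_, rfl, ?_⟩
    have hk₂ : k = 1 ∨ (k = 2 ∧ G.Adj (ι i) (ι t)) := by
      by_cases h : G.Adj (ι i) (ι t)
      · rw [label, if_pos h] at hk'
        simp only [h, and_true]
        omega
      · rw [label, if_neg h] at hk'
        omega
    rcases hk₂ with rfl | ⟨rfl, h⟩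
    · rw [altLetter_succ]
      simp only [altProd, altLetter, mul_one, hφ]
      by_cases h : G.Adj (ι i) (ι t)
      · have := finsupp_single_nonneg (c := 2⁻¹) (by norm_num) (refl G (ι t) (simple G (ι i)))
          (simple G (ι i))
        simp only [PosEntry, op_simple_adj 0 h]
        simp
        linarith
      · simp [PosEntry, op_simple_nonadj 0 (hι.ne hst) h]
    · rw [altLetter_succ, altLetter_succ]
      simp only [altProd, altLetter, mul_one, map_mul, hφ]
      simp only [PosEntry, Module.End.mul_apply, op_simple_adj 0 h.symm, map_add, map_smul,
        op_simple, op_refl_simple' 0 h.symm]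
      simp

end Monoid

end ArtinRoot

section Folding

variable {S : Type*} {M : S → S → ℕ}

/-- The graph obtained by unfolding a Coxeter graph into a triangle-free simply laced one. -/
def foldGraph (hsymm : ∀ s t, s ≠ t → M s t = M t s) : SimpleGraph (S × ℕ) where
  Adj p q := p.1 ≠ q.1 ∧ (p.2 + q.2) % 2 = 1 ∧
    (M p.1 q.1 = 0 ∨ (p.2 / (M p.1 q.1 - 1) = q.2 / (M p.1 q.1 - 1) ∧
      (p.2 = q.2 + 1 ∨ q.2 = p.2 + 1)))
  symm := ⟨by
    rintro p q ⟨h₁, h₂, h₃⟩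
    rw [hsymm _ _ h₁] at h₃
    exact ⟨h₁.symm, by rwa [add_comm], h₃.imp id fun h => ⟨h.1.symm, h.2.symm⟩⟩⟩
  loopless := ⟨fun _ h => h.1 rfl⟩

variable {hsymm : ∀ s t, s ≠ t → M s t = M t s} {s t : S}

lemma foldGraph_triangle_free (a b c : S × ℕ) (h₁ : (foldGraph hsymm).Adj a b)
    (h₂ : (foldGraph hsymm).Adj b c) : ¬ (foldGraph hsymm).Adj a c := by
  intro h₃
  have e₁ := h₁.2.1
  have e₂ := h₂.2.1
  have e₃ := h₃.2.1
  omega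

/-- The product of the first `N` elements in the fibre over `s`. -/
def fold {H : Type*} [Monoid H] (f : S × ℕ → H) (N : ℕ) (s : S) : H := rprod (fun k => f (s, k)) N

lemma map_fold {H K : Type*} [Monoid H] [Monoid K] (φ : H →* K) (f : S × ℕ → H) (N : ℕ) (s : S) :
    φ (fold f N s) = fold (φ ∘ f) N s := map_rprod φ _ N

lemma fold_eq_mul {H : Type*} [Monoid H] {f : S × ℕ → H} {N : ℕ} {s : S}
    (h : ∀ i j, Commute (f (s, i)) (f (s, j))) {k : ℕ} (hk : k < N) :
    ∃ g, fold f N s = f (s, k) * g ∧ fold f N s = g * f (s, k) :=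
  exists_rprod_eq_mul h hk

lemma altProd_fold {H : Type*} [Monoid H] {f : S × ℕ → H} {N : ℕ}
    (hcomm : ∀ p q, ¬ (foldGraph hsymm).Adj p q → Commute (f p) (f q))
    (hbr : ∀ p q, (foldGraph hsymm).Adj p q → f p * f q * f p = f q * f p * f q)
    (hst : s ≠ t) (hM : 2 ≤ M s t) (hN : M s t - 1 ∣ N) :
    altProd (fold f N s) (fold f N t) (M s t) = altProd (fold f N t) (fold f N s) (M s t) := by
  obtain ⟨B, rfl⟩ := hN
  obtain ⟨n, hn⟩ : ∃ n, M s t = n + 1 := ⟨M s t - 1, by omega⟩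
  simp only [fold, hn, Nat.add_sub_cancel]
  refine altProd_rprod (a := fun k => f (s, k)) (b := fun k => f (t, k))
    (fun k l => hcomm _ _ fun h => h.1 rfl) (fun k l => hcomm _ _ fun h => h.1 rfl) ?_ ?_ B
  · intro k l h
    refine hcomm _ _ fun h' => ?_
    have h'' := h'.2.2
    simp only [hn, Nat.add_sub_cancel] at h''
    exact h (h''.resolve_left (by omega))
  · intro k l h₁ h₂
    refine hbr _ _ ⟨hst, ?_, Or.inr ⟨?_, h₂⟩⟩
    · simp only
      omega
    · simpa [hn] using h₁

end Folding

namespace ArtinRoot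

section Path

variable {J : Type*} {G : SimpleGraph J} {x : ArtinRoot J}

open scoped Classical in
/-- The values `p` of `x` are determined by its coordinates in the finite set `Z`. -/
def IsSupported (G : SimpleGraph J) (Z : Finset J) (x : ArtinRoot J) : Prop :=
  ∀ q ∈ Z, x.p q = 2 * x.β q - ∑ r ∈ Z, if G.Adj q r then x.β r else 0

lemma isSupported_simple {Z : Finset J} {i : J} (hi : i ∈ Z) : IsSupported G Z (simple G i) := by
  classical
  intro q hq
  have h₁ : ∀ r ∈ Z, r ≠ i → (if G.Adj q r then (simple G i).β r else 0) = 0 := by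
    intro r _ hr
    simp [simple, hr]
  rw [Finset.sum_eq_single_of_mem i hi h₁]
  by_cases hqi : q = i
  · simp [simple, hqi]
  · simp [simple, hqi, G.adj_comm i q]
    split_ifs <;> simp

lemma IsSupported.congr {Z : Finset J} {y : ArtinRoot J} (hx : IsSupported G Z x)
    (hβ : y.β = x.β) (hp : y.p = x.p) : IsSupported G Z y := by
  intro q hq
  rw [hβ, hp]
  exact hx q hq

lemma IsSupported.refl {Z : Finset J} {i : J} (hx : IsSupported G Z x) (hi : i ∈ Z) :
    IsSupported G Z (refl G i x) := by
  classical
  intro q hq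
  have h := hx q hq
  have h₁ : (∑ r ∈ Z, if G.Adj q r then (ArtinRoot.refl G i x).β r else 0) =
      (∑ r ∈ Z, if G.Adj q r then x.β r else 0) - if G.Adj q i then x.p i else 0 := by
    rw [← Finset.sum_erase_add _ _ hi,
      ← Finset.sum_erase_add _ (fun r => if G.Adj q r then x.β r else 0) hi]
    have h₂ : ∀ r ∈ Z.erase i, (if G.Adj q r then (ArtinRoot.refl G i x).β r else 0) =
        if G.Adj q r then x.β r else 0 := by
      intro r hr
      simp [ArtinRoot.refl, Finset.ne_of_mem_erase hr]
    rw [Finset.sum_congr rfl h₂]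
    by_cases hqi : G.Adj q i <;> simp [ArtinRoot.refl, hqi]
    ring
  rw [h₁]
  by_cases hqi : q = i
  · subst hqi
    simp [ArtinRoot.refl]
    omega
  · by_cases ha : G.Adj q i
    · simp [ArtinRoot.refl, hqi, ha, ha.symm]
      omega
    · have ha' : ¬ G.Adj i q := fun h => ha h.symm
      simp [ArtinRoot.refl, hqi, ha, ha']
      omega

end Path

end ArtinRoot

section Walk

lemma rprod_mem {G : Type*} [Monoid G] {P : Submonoid G} {f : ℕ → G} (h : ∀ k, f k ∈ P) (n : ℕ) :
    rprod f n ∈ P := by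
  induction n with
  | zero => exact one_mem P
  | succ n ih => exact mul_mem ih (h n)

lemma altProd_mem {G : Type*} [Monoid G] {P : Submonoid G} {x y : G} (hx : x ∈ P) (hy : y ∈ P)
    (n : ℕ) : altProd x y n ∈ P := by
  induction n generalizing x y with
  | zero => exact one_mem P
  | succ n ih => exact mul_mem hx (ih hy hx)

namespace ArtinRoot

variable {S : Type*} {M : S → S → ℕ} {hsymm : ∀ s t, s ≠ t → M s t = M t s} {s t : S} {N : ℕ}
  {c : ℕ → ℝ} {x : ArtinRoot (S × ℕ)}

open scoped Classical in
/-- The vertices of the unfolded graph above `s` and `t`. -/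
noncomputable def fibres (N : ℕ) (s t : S) : Finset (S × ℕ) := {s, t} ×ˢ Finset.range N

lemma mem_fibres {p : S × ℕ} : p ∈ fibres N s t ↔ (p.1 = s ∨ p.1 = t) ∧ p.2 < N := by
  simp [fibres]

lemma fibres_comm (N : ℕ) (s t : S) : fibres N s t = fibres N t s := by
  ext p
  rw [mem_fibres, mem_fibres, or_comm]

/-- A weighted sum of the coordinates above `s`. -/
noncomputable def weight (c : ℕ → ℝ) (N : ℕ) (s : S) (x : ArtinRoot (S × ℕ)) : ℝ :=
  ∑ k ∈ Finset.range N, c k * x.β (s, k)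

lemma exists_posEntry_rprod (hst : s ≠ t) (hx : IsRoot (foldGraph hsymm) x)
    (hZ : IsSupported (foldGraph hsymm) (fibres N s t) x) (hs : 0 < weight c N s x) {n : ℕ}
    (hn : n ≤ N) :
    ∃ y, IsRoot (foldGraph hsymm) y ∧ IsSupported (foldGraph hsymm) (fibres N s t) y ∧
      PosEntry (rprod (fun k => op (foldGraph hsymm) 0 (t, k)) n) x y ∧
      (∀ k, y.β (s, k) = x.β (s, k)) ∧
      (∀ k, y.β (t, k) = x.β (t, k) - if k < n then x.p (t, k) else 0) ∧
      ∀ k, n ≤ k → y.p (t, k) = x.p (t, k) := by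
  induction n with
  | zero => exact ⟨x, hx, hZ, posEntry_one x, by simp, by simp, by simp⟩
  | succ n ih =>
    obtain ⟨y, hy, hyZ, hxy, hys, hyt, hyp⟩ := ih (by omega)
    have hne : y ≠ simple (foldGraph hsymm) (t, n) := by
      rintro rfl
      have h₀ : weight c N s x = 0 := by
        refine Finset.sum_eq_zero fun k _ => ?_
        rw [← hys]
        simp [simple, hst]
      exact hs.ne' h₀
    obtain ⟨w, hw, hyw, hwβ, hwp⟩ := exists_posEntry hy hne
    refine ⟨w, hw, (hyZ.refl (mem_fibres.2 ⟨Or.inr rfl, by simp only; omega⟩)).congr hwβ hwp,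
      hxy.mul (rprod_mem (fun _ => op_zero_mem_nonnegEnd _) n) (op_zero_mem_nonnegEnd _) hyw,
      fun k => ?_, fun k => ?_, fun k hk => ?_⟩
    · rw [hwβ, ← hys]
      simp [refl, hst]
    · rw [hwβ]
      by_cases hk : k = n
      · subst hk
        simp [refl, hyt, hyp]
      · have : k < n + 1 ↔ k < n := by omega
        simp [refl, hyt, hk, this]
    · have hne : (t, k) ≠ (t, n) := fun h => by
        rw [Prod.mk.injEq] at h
        omega
      have ha : ¬ (foldGraph hsymm).Adj (t, n) (t, k) := fun h => h.1 rfl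
      rw [hwp, refl_p_nonadj _ hne ha, hyp k (by omega)]

open scoped Classical in
/-- The weights `c` form an eigenvector of the incidence matrix between two fibres. -/
def IsEigen (hsymm : ∀ s t, s ≠ t → M s t = M t s) (N : ℕ) (c : ℕ → ℝ) (μ : ℝ) (s t : S) : Prop :=
  ∀ l < N, (∑ k ∈ Finset.range N, if (foldGraph hsymm).Adj (t, k) (s, l) then c k else 0) = μ * c l

lemma exists_posEntry_fold {μ : ℝ} (hst : s ≠ t) (hc : IsEigen hsymm N c μ s t)
    (hx : IsRoot (foldGraph hsymm) x)
    (hZ : IsSupported (foldGraph hsymm) (fibres N s t) x) (hs : 0 < weight c N s x) :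
    ∃ y, IsRoot (foldGraph hsymm) y ∧ IsSupported (foldGraph hsymm) (fibres N s t) y ∧
      PosEntry (fold (op (foldGraph hsymm) 0) N t) x y ∧
      weight c N s y = weight c N s x ∧
      weight c N t y = μ * weight c N s x - weight c N t x := by
  classical
  obtain ⟨y, hy, hyZ, hxy, hys, hyt, -⟩ := exists_posEntry_rprod hst hx hZ hs le_rfl
  refine ⟨y, hy, hyZ, hxy, ?_, ?_⟩
  · simp only [weight, hys]
  · have h₁ : ∀ k ∈ Finset.range N, c k * (y.β (t, k) : ℝ) =
        (∑ l ∈ Finset.range N, (if (foldGraph hsymm).Adj (t, k) (s, l) then c k else 0) *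
          (x.β (s, l) : ℝ)) - c k * x.β (t, k) := by
      intro k hk
      rw [Finset.mem_range] at hk
      have hp := hZ (t, k) (mem_fibres.2 ⟨Or.inr rfl, hk⟩)
      have h₂ : ∀ l, ¬ (foldGraph hsymm).Adj (t, k) (t, l) := fun l h => h.1 rfl
      rw [fibres, Finset.sum_product, Finset.sum_pair hst] at hp
      simp only [h₂, if_false, Finset.sum_const_zero, add_zero] at hp
      rw [hyt, if_pos hk, hp]
      push_cast
      simp only [ite_mul, zero_mul]
      rw [← sub_eq_zero]
      have : ∀ l, (if (foldGraph hsymm).Adj (t, k) (s, l) then c k * (x.β (s, l) : ℝ) else 0) =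
          c k * (if (foldGraph hsymm).Adj (t, k) (s, l) then (x.β (s, l) : ℝ) else 0) := by
        intro l
        split_ifs <;> simp
      simp only [this, ← Finset.mul_sum]
      ring
    simp only [weight]
    rw [Finset.sum_congr rfl h₁, Finset.sum_sub_distrib, Finset.sum_comm, Finset.mul_sum]
    congr 1
    refine Finset.sum_congr rfl fun l hl => ?_
    rw [← Finset.sum_mul, hc l (Finset.mem_range.1 hl), mul_assoc]

/-- An alternating product has a nonzero entry in row `x` as long as the corresponding
two-dimensional dynamics stays positive. -/
lemma exists_posEntry_altProd {μ : ℝ} {R : ℕ → ℝ → ℝ → Prop}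
    (hR : ∀ k a b, R (k + 1) a b → 0 < b ∧ R k b (μ * b - a)) (hst : s ≠ t)
    (hc : IsEigen hsymm N c μ s t) (hc' : IsEigen hsymm N c μ t s)
    (hx : IsRoot (foldGraph hsymm) x)
    (hZ : IsSupported (foldGraph hsymm) (fibres N s t) x) {k : ℕ}
    (hk : R k (weight c N t x) (weight c N s x)) :
    ∃ y, PosEntry
      (altProd (fold (op (foldGraph hsymm) 0) N t) (fold (op (foldGraph hsymm) 0) N s) k)
      x y := by
  induction k generalizing s t x with
  | zero => exact ⟨x, posEntry_one x⟩
  | succ k ih =>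
    obtain ⟨h₁, h₂⟩ := hR _ _ _ hk
    obtain ⟨y, hy, hyZ, hxy, hys, hyt⟩ := exists_posEntry_fold hst hc hx hZ h₁
    rw [← hyt] at h₂
    obtain ⟨w, hw⟩ := ih hst.symm hc' hc hy (fibres_comm N s t ▸ hyZ) (by rwa [hys])
    have hm : ∀ u, fold (op (foldGraph hsymm) 0) N u ∈ nonnegEnd _ :=
      fun u => rprod_mem (fun _ => op_zero_mem_nonnegEnd _) N
    exact ⟨w, hxy.mul (hm t) (altProd_mem (hm s) (hm t) k) hw⟩

end ArtinRoot

end Walk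

section Eigen

lemma succ_div_mod {n : ℕ} (hn : 0 < n) (l : ℕ) :
    (l % n + 1 < n → (l + 1) / n = l / n ∧ (l + 1) % n = l % n + 1) ∧
      (¬ l % n + 1 < n → (l + 1) / n = l / n + 1 ∧ (l + 1) % n = 0) := by
  have h₁ := Nat.mod_add_div l n
  have h₂ := Nat.mod_lt l hn
  refine ⟨fun h => (Nat.div_mod_unique hn).2 ⟨by omega, h⟩,
    fun h => (Nat.div_mod_unique hn).2 ⟨?_, hn⟩⟩
  rw [mul_add, mul_one]
  omega

lemma sum_range_neighbours {n B l : ℕ} (hn : 0 < n) (hl : l < n * B) (c : ℕ → ℝ) :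
    (∑ k ∈ Finset.range (n * B), if k / n = l / n ∧ (k = l + 1 ∨ l = k + 1) then c k else 0) =
      (if l % n + 1 < n then c (l + 1) else 0) + if 0 < l % n then c (l - 1) else 0 := by
  have h₁ : ∀ k, (if k / n = l / n ∧ (k = l + 1 ∨ l = k + 1) then c k else 0) =
      (if k = l + 1 then (if l % n + 1 < n then c (l + 1) else 0) else 0) +
        if k = l - 1 then (if 0 < l % n then c (l - 1) else 0) else 0 := by
    intro k
    have h₂ := succ_div_mod hn l
    have h₃ := succ_div_mod hn k
    by_cases hk : k = l + 1
    · subst hk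
      rw [if_neg (show ¬ l + 1 = l - 1 by omega), add_zero, if_pos rfl]
      by_cases h : l % n + 1 < n
      · rw [if_pos h, if_pos ⟨(h₂.1 h).1, Or.inl rfl⟩]
      · rw [if_neg h, if_neg]
        have := (h₂.2 h).1
        omega
    rw [if_neg hk, zero_add]
    by_cases hk' : l = k + 1
    · subst hk'
      rw [Nat.add_sub_cancel, if_pos rfl]
      by_cases h : k % n + 1 < n
      · rw [if_pos ⟨(h₃.1 h).1.symm, Or.inr rfl⟩, if_pos (by rw [(h₃.1 h).2]; omega)]
      · have h₄ := h₃.2 h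
        rw [if_neg (by omega), if_neg (by omega)]
    · rw [if_neg (by omega)]
      by_cases h : 0 < l % n
      · have : l ≠ 0 := by
          rintro rfl
          simp at h
        rw [if_neg (by omega)]
      · simp [h]
  have hl' : l % n + 1 < n → l + 1 < n * B := by
    intro h
    have h₂ := (succ_div_mod hn l).1 h
    have h₃ : l / n < B := Nat.div_lt_of_lt_mul hl
    exact (Nat.div_lt_iff_lt_mul hn).1 (h₂.1 ▸ h₃) |>.trans_eq (mul_comm _ _)
  simp only [h₁, Finset.sum_add_distrib, Finset.sum_ite_eq', Finset.mem_range]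
  congr 1
  · by_cases h : l % n + 1 < n
    · rw [if_pos (hl' h)]
    · simp [h]
  · rw [if_pos (by omega)]

lemma sum_range_odd (B l : ℕ) :
    (∑ k ∈ Finset.range (2 * B), if (k + l) % 2 = 1 then (1 : ℝ) else 0) = B := by
  induction B with
  | zero => simp
  | succ B ih =>
    rw [mul_add, mul_one, Finset.sum_range_succ, Finset.sum_range_succ, ih]
    by_cases h : (2 * B + l) % 2 = 1
    · rw [if_pos h, if_neg (by omega)]
      push_cast
      ring
    · rw [if_neg h, if_pos (by omega)]
      push_cast
      ring

namespace ArtinRoot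

open Real

variable {S : Type*} {M : S → S → ℕ} {hsymm : ∀ s t, s ≠ t → M s t = M t s} {s t : S} {N : ℕ}

lemma isEigen_sin {n : ℕ} (hst : s ≠ t) (hm : M s t = n + 1) (hn : 0 < n) (hN : n ∣ N) :
    IsEigen hsymm N (fun k => sin ((k % n + 1 : ℕ) * (π / (n + 1 : ℕ))))
      (2 * cos (π / (n + 1 : ℕ))) s t := by
  classical
  obtain ⟨B, rfl⟩ := hN
  intro l hl
  have hadj : ∀ k, (foldGraph hsymm).Adj (t, k) (s, l) ↔
      (k / n = l / n ∧ (k = l + 1 ∨ l = k + 1)) := by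
    intro k
    simp only [foldGraph, ← hsymm s t hst, hm]
    constructor
    · rintro ⟨-, -, h⟩
      simpa using h
    · intro h
      refine ⟨hst.symm, by omega, by simpa using h⟩
  simp only [hadj]
  rw [Finset.sum_congr rfl fun k _ => if_congr Iff.rfl rfl rfl, sum_range_neighbours hn hl]
  have h₁ : (if l % n + 1 < n then sin (((l + 1) % n + 1 : ℕ) * (π / (n + 1 : ℕ))) else 0) =
      sin ((l % n + 2 : ℕ) * (π / (n + 1 : ℕ))) := by
    split_ifs with h
    · rw [((succ_div_mod hn l).1 h).2]
    · have h₂ : l % n + 2 = n + 1 := by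
        have := Nat.mod_lt l hn
        omega
      rw [h₂, mul_div_cancel₀ _ (by positivity), sin_pi]
  have h₂ : (if 0 < l % n then sin (((l - 1) % n + 1 : ℕ) * (π / (n + 1 : ℕ))) else 0) =
      sin ((l % n : ℕ) * (π / (n + 1 : ℕ))) := by
    split_ifs with h
    · obtain ⟨k, rfl⟩ : ∃ k, l = k + 1 := ⟨l - 1, by have := Nat.mod_le l n; omega⟩
      by_cases hk : k % n + 1 < n
      · rw [((succ_div_mod hn k).1 hk).2, Nat.add_sub_cancel]
      · rw [((succ_div_mod hn k).2 hk).2] at h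
        omega
    · rw [show l % n = 0 by omega]
      simp
  rw [h₁, h₂]
  generalize π / (n + 1 : ℕ) = θ
  push_cast
  rw [show ((l % n : ℕ) + 2 : ℝ) * θ = ((l % n : ℕ) + 1 : ℝ) * θ + θ by ring,
    show ((l % n : ℕ) : ℝ) * θ = ((l % n : ℕ) + 1 : ℝ) * θ - θ by ring, sin_add, sin_sub]
  ring

lemma isEigen_one {B : ℕ} (hst : s ≠ t) (hm : M s t = 0) :
    IsEigen hsymm (2 * B) (fun _ => 1) B s t := by
  classical
  intro l _
  have hadj : ∀ k, (foldGraph hsymm).Adj (t, k) (s, l) ↔ (k + l) % 2 = 1 := by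
    intro k
    simp only [foldGraph, ← hsymm s t hst, hm]
    exact ⟨fun h => h.2.1, fun h => ⟨hst.symm, h, Or.inl trivial⟩⟩
  simp only [hadj]
  rw [mul_one, ← sum_range_odd B l]

lemma weight_simple_self {c : ℕ → ℝ} {k : ℕ} (hk : k < N) :
    weight c N s (simple (foldGraph hsymm) (s, k)) = c k := by
  rw [weight, Finset.sum_eq_single_of_mem k (Finset.mem_range.2 hk)]
  · simp [simple]
  · intro l _ hl
    simp [simple, hl]

lemma weight_simple_of_ne {c : ℕ → ℝ} {k : ℕ} (hst : s ≠ t) :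
    weight c N t (simple (foldGraph hsymm) (s, k)) = 0 :=
  Finset.sum_eq_zero fun l _ => by simp [simple, hst.symm]

lemma exists_posEntry_altProd_fold (h4 : 4 ∣ N) (hN : 0 < N) (hst : s ≠ t)
    (hM : M s t = 0 ∨ 2 ≤ M s t) (hMN : M s t ≠ 0 → M s t - 1 ∣ N) {k l : ℕ}
    (hk : M s t = 0 ∨ k < M s t) (hl : l < N) :
    ∃ y, PosEntry (altProd (fold (op (foldGraph hsymm) 0) N t)
      (fold (op (foldGraph hsymm) 0) N s) k) (simple (foldGraph hsymm) (s, l)) y := by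
  have hZ : IsSupported (foldGraph hsymm) (fibres N s t) (simple (foldGraph hsymm) (s, l)) :=
    isSupported_simple (mem_fibres.2 ⟨Or.inl rfl, hl⟩)
  rcases hM with hm | hm
  · obtain ⟨B, rfl⟩ := h4
    have hB : (2 : ℝ) ≤ (2 * B : ℕ) := by
      have : 2 ≤ 2 * B := by omega
      exact_mod_cast this
    have hm' : M t s = 0 := hsymm s t hst ▸ hm
    rw [show 4 * B = 2 * (2 * B) by ring]
    rw [show 4 * B = 2 * (2 * B) by ring] at hZ hl
    refine exists_posEntry_altProd (R := fun _ a b => 0 ≤ a ∧ a < b) ?_ hst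
      (isEigen_one hst hm) (isEigen_one hst.symm hm') (.simple _) hZ ?_
    · rintro _ a b ⟨ha, hab⟩
      refine ⟨by linarith, by linarith, ?_⟩
      nlinarith
    · rw [weight_simple_self hl, weight_simple_of_ne hst]
      norm_num
  · obtain ⟨n, hn⟩ : ∃ n, M s t = n + 1 := ⟨M s t - 1, by omega⟩
    have hn₀ : 0 < n := by omega
    have hd : n ∣ N := by simpa [hn] using hMN (by omega)
    have hn' : M t s = n + 1 := hsymm s t hst ▸ hn
    set θ : ℝ := π / (n + 1 : ℕ) with hθ
    have hsin : ∀ j, 0 < j → j < n + 1 → 0 < sin ((j : ℕ) * θ) := by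
      intro j hj hj'
      have hj₁ : (0 : ℝ) < j := by exact_mod_cast hj
      have hj₂ : (j : ℝ) < (n + 1 : ℕ) := by exact_mod_cast hj'
      refine sin_pos_of_pos_of_lt_pi (by positivity) ?_
      rw [hθ, ← mul_div_assoc, div_lt_iff₀ (by positivity), mul_comm]
      exact mul_lt_mul_of_pos_left hj₂ pi_pos
    refine exists_posEntry_altProd (μ := 2 * cos θ)
      (R := fun i a b => ∃ j : ℕ, ∃ C : ℝ, 0 < C ∧ a = C * sin (j * θ) ∧
        b = C * sin ((j + 1 : ℕ) * θ) ∧ j + i < n + 1) ?_ hst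
      (isEigen_sin hst hn hn₀ hd) (isEigen_sin hst.symm hn' hn₀ hd) (.simple _) hZ ?_
    · rintro i _ _ ⟨j, C, hC, rfl, rfl, hj⟩
      refine ⟨mul_pos hC (hsin _ (by omega) (by omega)), j + 1, C, hC, rfl, ?_, by omega⟩
      push_cast
      rw [show ((j : ℝ) + 1 + 1) * θ = (j + 1) * θ + θ by ring,
        show (j : ℝ) * θ = (j + 1) * θ - θ by ring, sin_add, sin_sub]
      ring
    · have h₁ := hsin 1 one_pos (by omega)
      have h₂ := hsin (l % n + 1) (by omega) (by have := Nat.mod_lt l hn₀; omega)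
      rw [weight_simple_self hl, weight_simple_of_ne hst]
      refine ⟨0, _, div_pos h₂ h₁, by simp, ?_, by omega⟩
      rw [zero_add, div_mul_cancel₀ _ h₁.ne']

end ArtinRoot

end Eigen

section Divisibility

lemma map_altLetter {α β : Type*} (f : α → β) (x y : α) (k : ℕ) :
    altLetter (f x) (f y) k = f (altLetter x y k) := by
  induction k generalizing x y with
  | zero => rfl
  | succ k ih => exact ih y x

namespace ArtinRoot

variable {S : Type*} {M : S → S → ℕ} {hsymm : ∀ s t, s ≠ t → M s t = M t s} {s t : S} {N : ℕ}

lemma op_commute {J : Type*} {G : SimpleGraph J} (θ : ℚ) {a b : J} (h : ¬ G.Adj a b) :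
    Commute (op G θ a) (op G θ b) :=
  (eq_or_ne a b).elim (fun hab => hab ▸ Commute.refl _) fun hab => op_comm θ hab h

lemma fold_op_eq_mul (θ : ℚ) (s : S) {k : ℕ} (hk : k < N) :
    ∃ g, fold (op (foldGraph hsymm) θ) N s = op (foldGraph hsymm) θ (s, k) * g ∧
      fold (op (foldGraph hsymm) θ) N s = g * op (foldGraph hsymm) θ (s, k) :=
  fold_eq_mul
    (fun _ _ => op_commute θ fun h : (foldGraph hsymm).Adj _ _ => h.1 rfl) hk

lemma exists_posEntry_altProd_fold_simple (h4 : 4 ∣ N) (hN : 0 < N) (hst : s ≠ t)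
    (hM : M s t = 0 ∨ 2 ≤ M s t) (hMN : M s t ≠ 0 → M s t - 1 ∣ N) {k l : ℕ} (hk₁ : 1 ≤ k)
    (hk : M s t = 0 ∨ k < M s t) (hl : l < N) :
    ∃ j : S × ℕ, j.2 < N ∧ j.1 = altLetter t s k ∧
      PosEntry (altProd (fold (op (foldGraph hsymm) 0) N t) (fold (op (foldGraph hsymm) 0) N s) k)
        (simple (foldGraph hsymm) (s, l)) (simple (foldGraph hsymm) j) := by
  classical
  let Y := {p : S × ℕ // (p.1 = s ∨ p.1 = t) ∧ p.2 < N}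
  have hι : Function.Injective (Subtype.val : Y → S × ℕ) := Subtype.val_injective
  let φ : ArtinMonoid Y (label (foldGraph hsymm) Subtype.val) →*
      Module.End ℚ (ArtinRoot (S × ℕ) →₀ ℚ) :=
    ArtinMonoid.lift (fun p => op (foldGraph hsymm) 0 p.1)
      fun a b hab _ => altProd_op foldGraph_triangle_free 0 hι hab
  have hφ : ∀ a, φ (ArtinMonoid.gen _ a) = op (foldGraph hsymm) 0 a.1 :=
    fun a => ArtinMonoid.lift_gen _ _ a
  let f : S × ℕ → ArtinMonoid Y (label (foldGraph hsymm) Subtype.val) := fun p =>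
    if h : (p.1 = s ∨ p.1 = t) ∧ p.2 < N then ArtinMonoid.gen _ ⟨p, h⟩ else 1
  have hf : ∀ u, u = s ∨ u = t → φ (fold f N u) = fold (op (foldGraph hsymm) 0) N u := by
    intro u hu
    rw [map_fold]
    refine rprod_congr fun k hk => ?_
    simp only [f, Function.comp_apply]
    rw [dif_pos ⟨hu, hk⟩, hφ]
  have hU : φ (altProd (fold f N t) (fold f N s) k) =
      altProd (fold (op (foldGraph hsymm) 0) N t) (fold (op (foldGraph hsymm) 0) N s) k := by
    rw [map_altProd, hf t (Or.inr rfl), hf s (Or.inl rfl)]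
  obtain ⟨j, hj⟩ := exists_posEntry_of_not_dvd hι φ hφ (altProd (fold f N t) (fold f N s) k)
    ⟨(s, l), Or.inl rfl, hl⟩ (by
      rintro ⟨c, hc⟩
      obtain ⟨y, hy⟩ := exists_posEntry_altProd_fold (hsymm := hsymm) h4 hN hst hM hMN hk hl
      rw [← hU, hc, map_mul, hφ] at hy
      exact hy.ne' (op_zero_apply_simple _ _))
  rw [hU] at hj
  refine ⟨j.1, j.2.2, ?_, hj⟩
  obtain ⟨k, rfl⟩ : ∃ i, k = i + 1 := ⟨k - 1, by omega⟩
  have hne : j.1.1 ≠ altLetter t s k := by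
    intro h
    rw [altProd_succ_right, map_altLetter (fold (op (foldGraph hsymm) 0) N), ← h] at hj
    obtain ⟨g, -, hg⟩ := fold_op_eq_mul (hsymm := hsymm) 0 j.1.1 j.2.2
    rw [hg, ← mul_assoc] at hj
    refine hj.ne' ?_
    rw [Module.End.mul_apply]
    change (_ * g) (op (foldGraph hsymm) 0 j.1 (e _)) _ = 0
    rw [op_simple]
    simp
  rw [altLetter_succ]
  rcases altLetter_cases t s k with ⟨h₁, h₂⟩ | ⟨h₁, h₂⟩ <;> rw [h₁] at hne <;> rw [h₂]
  · exact j.2.1.resolve_right hne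
  · exact j.2.1.resolve_left hne

lemma gen_dvd_iff (h4 : 4 ∣ N) (hN : 0 < N) (hM : ∀ s t, s ≠ t → M s t = 0 ∨ 2 ≤ M s t)
    (hMN : ∀ s t, s ≠ t → M s t ≠ 0 → M s t - 1 ∣ N)
    (φ : ArtinMonoid S M →* Module.End ℚ (ArtinRoot (S × ℕ) →₀ ℚ))
    (hφ : ∀ s, φ (ArtinMonoid.gen M s) = fold (op (foldGraph hsymm) 0) N s)
    (b : ArtinMonoid S M) (s : S) :
    ArtinMonoid.gen M s ∣ b ↔ ∀ v, φ b v (simple (foldGraph hsymm) (s, 0)) = 0 := by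
  constructor
  · rintro ⟨c, rfl⟩ v
    obtain ⟨g, hg, -⟩ := fold_op_eq_mul (hsymm := hsymm) 0 s hN
    rw [map_mul, hφ, hg, mul_assoc]
    exact op_zero_apply_simple _ _
  · intro h
    by_contra hb
    have hφ' : ∀ b, φ b ∈ nonnegEnd _ := by
      intro b
      obtain ⟨l, rfl⟩ := ArtinMonoid.exists_ofWord b
      induction l with
      | nil => simp [one_mem]
      | cons a l ih =>
        rw [ArtinMonoid.ofWord_cons, map_mul, hφ]
        exact mul_mem (rprod_mem (fun _ => op_zero_mem_nonnegEnd _) N) ih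
    obtain ⟨j, hj⟩ := ArtinMonoid.exists_of_not_dvd (I := {p : S × ℕ // p.2 < N})
      (τ := fun p => p.1.1) (P := fun b i j => PosEntry (φ b) (simple (foldGraph hsymm) i.1)
        (simple (foldGraph hsymm) j.1)) hsymm
      (fun i => by rw [map_one]; exact posEntry_one _)
      (fun a b i j k h₁ h₂ => by rw [map_mul]; exact h₁.mul (hφ' a) (hφ' b) h₂)
      (by
        rintro s t hst k hk₁ hk ⟨⟨u, l⟩, hl⟩ rfl
        obtain ⟨j, h₁, h₂, h₃⟩ := exists_posEntry_altProd_fold_simple (hsymm := hsymm) h4 hN hst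
          (hM _ _ hst) (hMN _ _ hst) hk₁ hk hl
        refine ⟨⟨j, h₁⟩, h₂, ?_⟩
        rw [map_altProd, hφ, hφ]
        exact h₃)
      b ⟨(s, 0), hN⟩ hb
    exact hj.ne' (h _)

end ArtinRoot

end Divisibility

section Faithfulness

/-- Families of vectors depending polynomially on a parameter. -/
inductive PolyFamily {V : Type*} [AddCommGroup V] [Module ℚ V] : (ℚ → V) → Prop
  | const (u : V) : PolyFamily fun _ => u
  | add {v w : ℚ → V} (hv : PolyFamily v) (hw : PolyFamily w) : PolyFamily fun θ => v θ + w θ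
  | smul {v : ℚ → V} (hv : PolyFamily v) : PolyFamily fun θ => θ • v θ

namespace PolyFamily

lemma map {V W : Type*} [AddCommGroup V] [Module ℚ V] [AddCommGroup W] [Module ℚ W]
    {v : ℚ → V} (hv : PolyFamily v) (T : V →ₗ[ℚ] W) : PolyFamily fun θ => T (v θ) := by
  induction hv with
  | const u => exact const (T u)
  | add _ _ h₁ h₂ => simpa only [map_add] using h₁.add h₂
  | smul _ h => simpa only [map_smul] using h.smul

lemma exists_polynomial {v : ℚ → ℚ} (hv : PolyFamily v) :
    ∃ p : Polynomial ℚ, ∀ θ, p.eval θ = v θ := by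
  induction hv with
  | const u => exact ⟨Polynomial.C u, by simp⟩
  | add _ _ h₁ h₂ =>
    obtain ⟨p, hp⟩ := h₁
    obtain ⟨q, hq⟩ := h₂
    exact ⟨p + q, by simp [hp, hq]⟩
  | smul _ h =>
    obtain ⟨p, hp⟩ := h
    exact ⟨Polynomial.X * p, by simp [hp]⟩

lemma apply_zero_eq {v w : ℚ → ℚ} (hv : PolyFamily v) (hw : PolyFamily w)
    (h : ∀ θ, θ ≠ 0 → v θ = w θ) : v 0 = w 0 := by
  obtain ⟨p, hp⟩ := hv.exists_polynomial
  obtain ⟨q, hq⟩ := hw.exists_polynomial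
  have hpq : p = q := by
    refine Polynomial.eq_of_infinite_eval_eq p q (Set.Infinite.mono ?_
      (Set.finite_singleton (0 : ℚ)).infinite_compl)
    intro θ hθ
    simp only [Set.mem_ofPred_eq, hp, hq]
    exact h θ hθ
  rw [← hp, ← hq, hpq]

end PolyFamily

namespace ArtinRoot

variable {S : Type*} {M : S → S → ℕ} {hsymm : ∀ s t, s ≠ t → M s t = M t s} {N : ℕ}

lemma polyFamily_op {J : Type*} {G : SimpleGraph J} {v : ℚ → ArtinRoot J →₀ ℚ} (hv : PolyFamily v)
    (s : J) : PolyFamily fun θ => op G θ s (v θ) := by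
  have h := (hv.map (op G 0 s)).add (hv.map (op G 1 s - op G 0 s)).smul
  refine cast (congrArg PolyFamily (funext fun θ => ?_)) h
  rw [op_affine θ s]
  rfl

lemma polyFamily_fold {v : ℚ → ArtinRoot (S × ℕ) →₀ ℚ} (hv : PolyFamily v) (s : S) :
    PolyFamily fun θ => fold (op (foldGraph hsymm) θ) N s (v θ) := by
  unfold fold
  induction N generalizing v with
  | zero => exact hv
  | succ N ih => exact ih (polyFamily_op hv (s, N))

section Representation

variable (hsymm) (hM : ∀ s t, s ≠ t → M s t = 0 ∨ 2 ≤ M s t)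
  (hMN : ∀ s t, s ≠ t → M s t ≠ 0 → M s t - 1 ∣ N)

/-- The linear representation of the Artin monoid. -/
noncomputable def rep (θ : ℚ) : ArtinMonoid S M →* Module.End ℚ (ArtinRoot (S × ℕ) →₀ ℚ) :=
  ArtinMonoid.lift (fold (op (foldGraph hsymm) θ) N) fun s t hst h =>
    altProd_fold (hsymm := hsymm) (fun _ _ => op_commute θ)
      (fun _ _ => op_braid θ foldGraph_triangle_free) hst ((hM s t hst).resolve_left h)
      (hMN s t hst h)

/-- The linear representation of the Artin group. -/
noncomputable def groupRep {θ : ℚ} (hθ : θ ≠ 0) :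
    ArtinGroup S M →* (Module.End ℚ (ArtinRoot (S × ℕ) →₀ ℚ))ˣ :=
  PresentedGroup.toGroup (f := fold (opUnit hθ (foldGraph hsymm)) N) (by
    rintro _ ⟨s, t, hst, h, rfl⟩
    rw [map_mul, map_inv, map_altProd, map_altProd, FreeGroup.lift_apply_of,
      FreeGroup.lift_apply_of, mul_inv_eq_one]
    exact altProd_fold (hsymm := hsymm) (fun p q hpq => Units.ext (op_commute θ hpq).eq)
      (fun p q hpq => Units.ext (op_braid θ foldGraph_triangle_free hpq)) hst
      ((hM s t hst).resolve_left h) (hMN s t hst h))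

lemma rep_gen (θ : ℚ) (s : S) : rep hsymm hM hMN θ (ArtinMonoid.gen M s) =
    fold (op (foldGraph hsymm) θ) N s := ArtinMonoid.lift_gen _ _ s

lemma polyFamily_rep (b : ArtinMonoid S M) (v : ArtinRoot (S × ℕ) →₀ ℚ) :
    PolyFamily fun θ => rep hsymm hM hMN θ b v := by
  obtain ⟨l, rfl⟩ := ArtinMonoid.exists_ofWord b
  induction l with
  | nil => simpa using PolyFamily.const v
  | cons s l ih =>
    simpa only [ArtinMonoid.ofWord_cons, map_mul, rep_gen, Module.End.mul_apply] using
      polyFamily_fold ih s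

lemma groupRep_eq_rep {θ : ℚ} (hθ : θ ≠ 0) (f : ArtinMonoid S M →* ArtinGroup S M)
    (hf : ∀ s, f (ArtinMonoid.gen M s) = PresentedGroup.of s) (b : ArtinMonoid S M) :
    (groupRep hsymm hM hMN hθ (f b) : Module.End ℚ _) = rep hsymm hM hMN θ b := by
  obtain ⟨l, rfl⟩ := ArtinMonoid.exists_ofWord b
  induction l with
  | nil => simp
  | cons s l ih =>
    rw [ArtinMonoid.ofWord_cons, map_mul, map_mul, map_mul, Units.val_mul, ih, rep_gen, hf,
      groupRep, PresentedGroup.toGroup.of]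
    congr 1
    exact map_fold (Units.coeHom _) _ N s

lemma rep_zero_eq (f : ArtinMonoid S M →* ArtinGroup S M)
    (hf : ∀ s, f (ArtinMonoid.gen M s) = PresentedGroup.of s) {b b' : ArtinMonoid S M}
    (h : f b = f b') : rep hsymm hM hMN 0 b = rep hsymm hM hMN 0 b' := by
  refine LinearMap.ext fun v => Finsupp.ext fun y => ?_
  refine ((polyFamily_rep hsymm hM hMN b v).map (Finsupp.lapply y)).apply_zero_eq
    ((polyFamily_rep hsymm hM hMN b' v).map (Finsupp.lapply y)) fun θ hθ => ?_
  rw [← groupRep_eq_rep hsymm hM hMN hθ f hf, ← groupRep_eq_rep hsymm hM hMN hθ f hf, h]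

end Representation

end ArtinRoot

namespace ArtinMonoid

variable {S : Type*} {M : S → S → ℕ}

lemma exists_fold_size [Fintype S] (M : S → S → ℕ) :
    ∃ N, 0 < N ∧ 4 ∣ N ∧ ∀ s t, M s t - 1 ≠ 0 → M s t - 1 ∣ N := by
  refine ⟨4 * ∏ s, ∏ t, max 1 (M s t - 1), ?_, ⟨_, rfl⟩, fun s t h => ?_⟩
  · exact Nat.mul_pos (by norm_num)
      (Finset.prod_pos fun s _ => Finset.prod_pos fun t _ => by simp)
  · have h₁ : max 1 (M s t - 1) = M s t - 1 := max_eq_right (by omega)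
    rw [← h₁]
    exact ((Finset.dvd_prod_of_mem _ (Finset.mem_univ t)).trans
      (Finset.dvd_prod_of_mem (fun s => ∏ t, max 1 (M s t - 1)) (Finset.mem_univ s))).mul_left 4

lemma not_gen_dvd_one (s : S) : ¬ gen M s ∣ 1 := by
  rintro ⟨c, hc⟩
  have h₁ := congrArg length hc
  have h₂ := length_mul (1 : ArtinMonoid S M) 1
  rw [length_gen_mul] at h₁
  rw [mul_one] at h₂
  omega

theorem injective_of_gen [Fintype S] (hsymm : ∀ s t, s ≠ t → M s t = M t s)
    (hM : ∀ s t, s ≠ t → M s t = 0 ∨ 2 ≤ M s t) (f : ArtinMonoid S M →* ArtinGroup S M)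
    (hf : ∀ s, f (gen M s) = PresentedGroup.of s) : Function.Injective f := by
  obtain ⟨N, hN, h4, hd⟩ := exists_fold_size M
  have hMN : ∀ s t, s ≠ t → M s t ≠ 0 → M s t - 1 ∣ N := fun s t hst h =>
    hd s t (by have := hM s t hst; omega)
  have hdvd : ∀ {b b'}, f b = f b' → ∀ s, gen M s ∣ b → gen M s ∣ b' := by
    intro b b' h s
    rw [ArtinRoot.gen_dvd_iff h4 hN hM hMN _ (ArtinRoot.rep_gen hsymm hM hMN 0),
      ArtinRoot.gen_dvd_iff h4 hN hM hMN _ (ArtinRoot.rep_gen hsymm hM hMN 0),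
      ArtinRoot.rep_zero_eq hsymm hM hMN f hf h]
    exact id
  intro b b' h
  obtain ⟨l, rfl⟩ := exists_ofWord b
  induction l generalizing b' with
  | nil =>
    rcases eq_one_or_gen_mul b' with rfl | ⟨s, c, rfl⟩
    · rfl
    · exact absurd (hdvd h.symm s ⟨c, rfl⟩) (not_gen_dvd_one s)
  | cons s l ih =>
    obtain ⟨c, rfl⟩ := hdvd h s ⟨_, ofWord_cons s l⟩
    rw [ofWord_cons, map_mul, map_mul] at h
    rw [ofWord_cons, ih (mul_left_cancel h)]

end ArtinMonoid

end Faithfulness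

/-- (Paris) Every Artin monoid injects in its Artin group: for any Coxeter graph `Γ` over
a finite set `S` (labels in `{2,3,…} ∪ {∞}`, with `∞` encoded by `0`), the canonical
monoid homomorphism `A⁺(Γ) → A(Γ)`, `σ_s ↦ σ_s`, is (well defined and) injective;
moreover two positive words represent the same element of `A(Γ)` if and only if they
represent the same element of `A⁺(Γ)`. -/
theorem artin_monoid_injects (S : Type*) [Fintype S] (M : S → S → ℕ)
    (hsymm : ∀ s t : S, s ≠ t → M s t = M t s)
    (hM : ∀ s t : S, s ≠ t → M s t = 0 ∨ 2 ≤ M s t) :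
    (∃ f : ArtinMonoid S M →* ArtinGroup S M,
        (∀ s : S, f ((conGen (ArtinMonoidRel S M)).mk' (FreeMonoid.of s)) =
          PresentedGroup.of s) ∧
        Function.Injective f) ∧
    (∀ u v : FreeMonoid S,
        FreeMonoid.lift (fun s => (PresentedGroup.of s : ArtinGroup S M)) u =
          FreeMonoid.lift (fun s => (PresentedGroup.of s : ArtinGroup S M)) v ↔
        (conGen (ArtinMonoidRel S M)).mk' u = (conGen (ArtinMonoidRel S M)).mk' v) := by
  let f : ArtinMonoid S M →* ArtinGroup S M := ArtinMonoid.lift PresentedGroup.of (by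
    intro s t hst h
    have h₁ := PresentedGroup.one_of_mem (rels := artinRels S M) ⟨s, t, hst, h, rfl⟩
    rw [map_mul, map_inv, map_altProd, map_altProd, mul_inv_eq_one] at h₁
    exact h₁)
  have hf : ∀ s, f (ArtinMonoid.gen M s) = PresentedGroup.of s := ArtinMonoid.lift_gen _ _
  have hinj := ArtinMonoid.injective_of_gen hsymm hM f hf
  refine ⟨⟨f, hf, hinj⟩, fun u v => ?_⟩
  have hlift : FreeMonoid.lift (fun s => (PresentedGroup.of s : ArtinGroup S M)) =
      f.comp (conGen (ArtinMonoidRel S M)).mk' :=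
    FreeMonoid.hom_eq fun s => (hf s).symm
  rw [hlift]
  exact hinj.eq_iff (a := (conGen (ArtinMonoidRel S M)).mk' u)
    (b := (conGen (ArtinMonoidRel S M)).mk' v)
end
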